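/- arXiv:1508.05277 — 2 statements merged into one kernel-verified Lean document; each statement's English description precedes it below -/
import Mathlib

section
/- Let p and q be distinct primes and K a field. If K admits two nontrivial (p,q)-henselian valuations which are independent, then K = K(p,q): every finite Galois extension of K whose degree is of the form p^n q^m is trivial. -/
noncomputable section

/-- The maximal `(p,q)`-extension of `K` inside an ambient field extension `Ω`:
the compositum of all finite Galois subextensions of `Ω/K` of degree `p^n * q^m`. -/
def maxPQExt (p q : ℕ) (K Ω : Type*) [Field K] [Field Ω] [Algebra K Ω] :
    IntermediateField K Ω :=
  ⨆ L : {L : IntermediateField K Ω //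
      FiniteDimensional K ↥L ∧ IsGalois K ↥L ∧
        ∃ n m : ℕ, Module.finrank K ↥L = p ^ n * q ^ m}, L.1

/-- A valuation (subring) of `K` is `(p,q)`-henselian if it extends uniquely to `K(p,q)`. -/
def IsPQHenselian (p q : ℕ) {K : Type*} [Field K] (O : ValuationSubring K) : Prop :=
  ∃! O' : ValuationSubring ↥(maxPQExt p q K (AlgebraicClosure K)),
    O'.comap (algebraMap K ↥(maxPQExt p q K (AlgebraicClosure K))) = O

open IntermediateField

/-- `d` has the form `p ^ n * q ^ m`. -/
def IsPQPow (p q d : ℕ) : Prop := ∃ n m : ℕ, d = p ^ n * q ^ m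

lemma IsPQPow.of_dvd {p q d e : ℕ} (hp : p.Prime) (hq : q.Prime) (he : IsPQPow p q e)
    (h : d ∣ e) : IsPQPow p q d := by
  obtain ⟨n, m, rfl⟩ := he
  obtain ⟨a, b, ha, hb, rfl⟩ := (Nat.dvd_mul).1 h
  obtain ⟨i, -, rfl⟩ := (Nat.dvd_prime_pow hp).1 ha
  obtain ⟨j, -, rfl⟩ := (Nat.dvd_prime_pow hq).1 hb
  exact ⟨i, j, rfl⟩

lemma IsPQPow.mul {p q d e : ℕ} (hd : IsPQPow p q d) (he : IsPQPow p q e) :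
    IsPQPow p q (d * e) := by
  obtain ⟨n, m, rfl⟩ := hd
  obtain ⟨i, j, rfl⟩ := he
  exact ⟨n + i, m + j, by ring⟩

section FieldTheory

variable {K Ω : Type*} [Field K] [Field Ω] [Algebra K Ω]

lemma finrank_sup_dvd_of_isGalois (A B : IntermediateField K Ω) [FiniteDimensional K A]
    [FiniteDimensional K B] [IsGalois K A] [IsGalois K B] :
    Module.finrank K ↥(A ⊔ B) ∣ Module.finrank K A * Module.finrank K B := by
  have : IsGalois K ↥(A ⊔ B) := inferInstance
  let _ := (inclusion (le_sup_left : A ≤ A ⊔ B)).toAlgebra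
  let _ := (inclusion (le_sup_right : B ≤ A ⊔ B)).toAlgebra
  have : IsScalarTower K A ↥(A ⊔ B) := IsScalarTower.of_algebraMap_eq fun _ ↦ rfl
  have : IsScalarTower K B ↥(A ⊔ B) := IsScalarTower.of_algebraMap_eq fun _ ↦ rfl
  rw [← IsGalois.card_aut_eq_finrank, ← IsGalois.card_aut_eq_finrank K A,
    ← IsGalois.card_aut_eq_finrank K B, ← Nat.card_prod]
  refine Subgroup.card_dvd_of_injective
    ((AlgEquiv.restrictNormalHom (F := K) (K₁ := ↥(A ⊔ B)) A).prod
      (AlgEquiv.restrictNormalHom (F := K) (K₁ := ↥(A ⊔ B)) B)) ?_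
  refine (injective_iff_map_eq_one _).2 fun σ hσ ↦ ?_
  have h1 := congrArg Prod.fst hσ
  have h2 := congrArg Prod.snd hσ
  have key : (⊤ : IntermediateField K ↥(A ⊔ B)) ≤ fixedField (Subgroup.zpowers σ) := by
    have hA : ∀ x (hx : x ∈ A ⊔ B), x ∈ A → σ ⟨x, hx⟩ = ⟨x, hx⟩ := by
      intro x hx hxA
      have := AlgEquiv.restrictNormal_commutes σ A ⟨x, hxA⟩
      rw [show σ.restrictNormal A = 1 from h1] at this
      exact this.symm
    have hB : ∀ x (hx : x ∈ A ⊔ B), x ∈ B → σ ⟨x, hx⟩ = ⟨x, hx⟩ := by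
      intro x hx hxB
      have := AlgEquiv.restrictNormal_commutes σ B ⟨x, hxB⟩
      rw [show σ.restrictNormal B = 1 from h2] at this
      exact this.symm
    have hle : A ⊔ B ≤ (fixedField (Subgroup.zpowers σ)).map (A ⊔ B).val := by
      have fix : ∀ z : ↥(A ⊔ B), σ z = z → z ∈ fixedField (Subgroup.zpowers σ) := by
        intro z hz
        rw [mem_fixedField_iff]
        intro f hf
        have : Subgroup.zpowers σ ≤ MulAction.stabilizer _ z :=
          (Subgroup.zpowers_le).2 hz
        exact this hf
      refine sup_le (fun x hx ↦ ?_) (fun x hx ↦ ?_)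
      · exact ⟨⟨x, le_sup_left (a := A) hx⟩, fix _ (hA _ _ hx), rfl⟩
      · exact ⟨⟨x, le_sup_right (a := A) hx⟩, fix _ (hB _ _ hx), rfl⟩
    rintro ⟨x, hx⟩ -
    obtain ⟨z, hz, hzx⟩ := hle hx
    have : z = ⟨x, hx⟩ := Subtype.ext hzx
    exact this ▸ hz
  ext x
  have := key (x := x) trivial
  rw [mem_fixedField_iff] at this
  rw [this σ (Subgroup.mem_zpowers σ)]
  rfl

variable {p q : ℕ}

lemma le_maxPQExt {L : IntermediateField K Ω} [FiniteDimensional K L] [IsGalois K L]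
    (h : IsPQPow p q (Module.finrank K L)) : L ≤ maxPQExt p q K Ω :=
  le_iSup (fun L : {L : IntermediateField K Ω //
      FiniteDimensional K ↥L ∧ IsGalois K ↥L ∧
        ∃ n m : ℕ, Module.finrank K ↥L = p ^ n * q ^ m} ↦ L.1) ⟨L, inferInstance, inferInstance, h⟩

lemma exists_of_mem_maxPQExt (hp : p.Prime) (hq : q.Prime) {x : Ω}
    (hx : x ∈ maxPQExt p q K Ω) :
    ∃ L : IntermediateField K Ω, FiniteDimensional K L ∧ IsGalois K L ∧
      IsPQPow p q (Module.finrank K L) ∧ x ∈ L := by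
  rw [maxPQExt, ← SetLike.mem_coe] at hx
  have : Nonempty {L : IntermediateField K Ω //
      FiniteDimensional K ↥L ∧ IsGalois K ↥L ∧
        ∃ n m : ℕ, Module.finrank K ↥L = p ^ n * q ^ m} :=
    ⟨⊥, inferInstance, inferInstance, 0, 0, by simp⟩
  rw [coe_iSup_of_directed, Set.mem_iUnion] at hx
  · obtain ⟨⟨L, h1, h2, h3⟩, hxL⟩ := hx
    exact ⟨L, h1, h2, h3, hxL⟩
  · rintro ⟨A, hA1, hA2, hA3⟩ ⟨B, hB1, hB2, hB3⟩
    have hAB : IsPQPow p q (Module.finrank K ↥(A ⊔ B)) :=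
      IsPQPow.of_dvd hp hq (IsPQPow.mul hA3 hB3) (finrank_sup_dvd_of_isGalois A B)
    exact ⟨⟨A ⊔ B, inferInstance, inferInstance, hAB⟩, le_sup_left, le_sup_right⟩

lemma isSeparable_of_mem_maxPQExt (hp : p.Prime) (hq : q.Prime) {x : Ω}
    (hx : x ∈ maxPQExt p q K Ω) : IsSeparable K x := by
  obtain ⟨L, h1, h2, -, hxL⟩ := exists_of_mem_maxPQExt hp hq hx
  have := Algebra.IsSeparable.isSeparable K (⟨x, hxL⟩ : L)
  rwa [IsSeparable, minpoly_eq] at this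

instance normal_maxPQExt : Normal K (maxPQExt p q K Ω) := by
  have (L : {L : IntermediateField K Ω //
      FiniteDimensional K ↥L ∧ IsGalois K ↥L ∧
        ∃ n m : ℕ, Module.finrank K ↥L = p ^ n * q ^ m}) : Normal K L.1 :=
    have := L.2.2.1
    inferInstance
  exact normal_iSup K Ω _

lemma isSeparable_algEquiv_apply (σ : Ω ≃ₐ[K] Ω) {x : Ω} (hx : IsSeparable K x) :
    IsSeparable K (σ x) := by
  rwa [IsSeparable, minpoly.algEquiv_eq]

variable [Normal K Ω]

lemma apply_mem_of_normal (F : IntermediateField K Ω) [Normal K F] (σ : Ω ≃ₐ[K] Ω) {x : Ω}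
    (hx : x ∈ F) : σ x ∈ F :=
  normal_iff_forall_map_le.1 ‹Normal K F› σ.toAlgHom ⟨x, hx, rfl⟩

lemma mem_of_forall_fixingSubgroup (F : IntermediateField K Ω) {x : Ω} (hx : IsSeparable K x)
    (h : ∀ σ ∈ F.fixingSubgroup, σ x = x) : x ∈ F := by
  have hsep : IsSeparable F x := hx.tower_top F
  have : Normal F Ω := Normal.tower_top_of_normal K F Ω
  by_contra hxF
  have hxF' : x ∉ (⊥ : Subalgebra F Ω) := by
    rintro ⟨z, rfl⟩
    exact hxF z.2
  obtain ⟨y, hne, hy⟩ := (notMem_iff_exists_ne_and_isConjRoot hsep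
    (Normal.splits ‹Normal F Ω› x)).1 hxF'
  obtain ⟨σ, hσ⟩ := hy.symm.exists_algEquiv
  refine hne.symm (hσ.symm.trans (h (σ.restrictScalars K) ?_))
  rw [IntermediateField.mem_fixingSubgroup_iff]
  exact fun z hz ↦ σ.commutes ⟨z, hz⟩

/-- Elements on which the absolute Galois group of `F = K(p,q)` acts through a group of prime
exponent `p` or `q` already lie in `F`. -/
lemma mem_maxPQExt_of_forall_pow (hp : p.Prime) (hq : q.Prime) {l : ℕ} (hl : l = p ∨ l = q)
    {y : Ω} (hy : IsSeparable K y)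
    (h : ∀ σ ∈ (maxPQExt p q K Ω).fixingSubgroup, (σ ^ l) y = y) : y ∈ maxPQExt p q K Ω := by
  set F := maxPQExt p q K Ω with hF
  have hlp : Fact l.Prime := ⟨by rcases hl with rfl | rfl <;> assumption⟩
  let E := normalClosure K K⟮y⟯ Ω
  have hyE : y ∈ E := le_normalClosure _ (mem_adjoin_simple_self K y)
  have : FiniteDimensional K K⟮y⟯ := adjoin.finiteDimensional hy.isIntegral
  have : Algebra.IsSeparable K K⟮y⟯ := (isSeparable_adjoin_simple_iff_isSeparable K Ω).2 hy
  have hEsep : E ≤ separableClosure K Ω := by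
    simp only [E]
    rw [normalClosure_def'']
    refine iSup_le fun τ ↦ ?_
    rw [adjoin_map, Set.image_singleton, adjoin_simple_le_iff, mem_separableClosure_iff]
    exact isSeparable_algEquiv_apply τ hy
  have : Algebra.IsSeparable K E := (le_separableClosure_iff K Ω E).1 hEsep
  have : IsGalois K E := ⟨⟩
  have : FiniteDimensional K E := inferInstance
  have hfix : ∀ σ ∈ F.fixingSubgroup, ∀ x ∈ E, (σ ^ l) x = x := by
    intro σ hσ
    suffices E ≤ fixedField (Subgroup.zpowers (σ ^ l)) by
      intro x hx
      exact (mem_fixedField_iff _ _).1 (this hx) _ (Subgroup.mem_zpowers _)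
    simp only [E]
    rw [normalClosure_def'']
    refine iSup_le fun τ ↦ ?_
    rw [adjoin_map, Set.image_singleton, adjoin_simple_le_iff, mem_fixedField_iff]
    intro f hf
    have hle : Subgroup.zpowers (σ ^ l) ≤ MulAction.stabilizer _ (τ y) := by
      refine Subgroup.zpowers_le.2 ?_
      have hc : τ⁻¹ * σ * τ⁻¹⁻¹ ∈ F.fixingSubgroup := by
        rw [IntermediateField.mem_fixingSubgroup_iff] at hσ ⊢
        intro x hx
        simp only [inv_inv, AlgEquiv.mul_apply]
        rw [hσ _ (apply_mem_of_normal F τ hx), ← AlgEquiv.mul_apply, inv_mul_cancel,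
          AlgEquiv.one_apply]
      have := h _ hc
      rw [conj_pow] at this
      change (σ ^ l) (τ y) = τ y
      conv_rhs => rw [← this]
      simp only [← AlgEquiv.mul_apply]
      congr 1
      group
    exact hle hf
  let S : Subgroup Gal(E/K) := F.fixingSubgroup.map (AlgEquiv.restrictNormalHom E)
  have hS : IsPGroup l S := by
    rintro ⟨_, σ, hσ, rfl⟩
    refine ⟨1, ?_⟩
    ext x
    simp only [pow_one]
    change ((AlgEquiv.restrictNormalHom E σ ^ l) x : Ω) = x
    rw [← map_pow, AlgEquiv.restrictNormalHom_apply]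
    exact hfix σ hσ x x.2
  obtain ⟨k, hk⟩ := IsPGroup.iff_card.1 hS
  have hbot : IsPQPow p q (Module.finrank K (fixedField S)) := by
    obtain ⟨α, hα⟩ := Field.exists_primitive_element K (fixedField S)
    have hαF : ((α : E) : Ω) ∈ F := by
      refine mem_of_forall_fixingSubgroup F ?_ fun σ hσ ↦ ?_
      · have := Algebra.IsSeparable.isSeparable K (α : E)
        rwa [IsSeparable, minpoly_eq] at this
      · have := (mem_fixedField_iff _ _).1 α.2 _ (Subgroup.mem_map_of_mem _ hσ)
        rw [← AlgEquiv.restrictNormalHom_apply, this]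
    obtain ⟨L, h1, h2, h3, h4⟩ := exists_of_mem_maxPQExt hp hq hαF
    refine h3.of_dvd hp hq ?_
    rw [← finrank_top', ← hα, adjoin.finrank (Algebra.IsIntegral.isIntegral α), minpoly_eq,
      minpoly_eq, ← minpoly_eq (S := L) ⟨_, h4⟩]
    exact minpoly.degree_dvd (Algebra.IsIntegral.isIntegral _)
  have hE : IsPQPow p q (Module.finrank K E) := by
    rw [← Module.finrank_mul_finrank K (fixedField S) E, finrank_fixedField_eq_card, hk]
    refine hbot.mul ?_
    rcases hl with rfl | rfl
    · exact ⟨k, 0, by simp⟩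
    · exact ⟨0, k, by simp⟩
  exact le_maxPQExt hE hyE

end FieldTheory

/-- The product `∏ i < n, δ^i(c) ^ (k ^ (n - 1 - i))`. -/
def eigenProd {K Ω : Type*} [Field K] [Field Ω] [Algebra K Ω] (δ : Ω ≃ₐ[K] Ω) (k : ℕ) (c : Ω) :
    ℕ → Ω
  | 0 => 1
  | n + 1 => c ^ k ^ n * δ (eigenProd δ k c n)

section EigenProd

variable {K Ω : Type*} [Field K] [Field Ω] [Algebra K Ω] (δ : Ω ≃ₐ[K] Ω) (k : ℕ)

lemma eigenProd_succ (c : Ω) (n : ℕ) :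
    eigenProd δ k c (n + 1) = c ^ k ^ n * δ (eigenProd δ k c n) := rfl

lemma eigenProd_succ' (c : Ω) (n : ℕ) :
    eigenProd δ k c (n + 1) = eigenProd δ k c n ^ k * (δ ^ n) c := by
  induction n with
  | zero => simp [eigenProd]
  | succ n ih =>
    have h := congrArg δ ih
    rw [map_mul, map_pow, ← AlgEquiv.mul_apply, ← pow_succ'] at h
    rw [eigenProd_succ δ k c (n + 1), h, eigenProd_succ δ k c n]
    ring

lemma eigenProd_mul (a b : Ω) (n : ℕ) :
    eigenProd δ k (a * b) n = eigenProd δ k a n * eigenProd δ k b n := by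
  induction n with
  | zero => simp [eigenProd]
  | succ n ih => simp only [eigenProd_succ, ih, map_mul, mul_pow]; ring

lemma eigenProd_pow (a : Ω) (m n : ℕ) :
    eigenProd δ k (a ^ m) n = eigenProd δ k a n ^ m := by
  induction m with
  | zero =>
    rw [pow_zero, pow_zero]
    induction n with
    | zero => rfl
    | succ n ih => simp [eigenProd_succ, ih]
  | succ m ih => rw [pow_succ, eigenProd_mul, ih, pow_succ]

lemma eigenProd_one (n : ℕ) : eigenProd δ k 1 n = 1 := by
  simpa using eigenProd_pow δ k 1 0 n

lemma eigenProd_ne_zero {c : Ω} (hc : c ≠ 0) (n : ℕ) : eigenProd δ k c n ≠ 0 := by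
  induction n with
  | zero => exact one_ne_zero
  | succ n ih =>
    exact mul_ne_zero (pow_ne_zero _ hc) ((map_ne_zero δ).2 ih)

end EigenProd

/-- A primitive `p`-th root of unity `ζ` over `F`, together with an automorphism `δ` generating
the Galois group of `F(ζ)/F`. -/
structure KummerDatum {K Ω : Type*} [Field K] [Field Ω] [Algebra K Ω]
    (F : IntermediateField K Ω) (p : ℕ) where
  /-- the root of unity -/
  ζ : Ω
  /-- the exponent by which `δ` acts on `ζ` -/
  k : ℕ
  /-- the degree of `F(ζ)/F` -/
  d : ℕ
  /-- the quotient `(k ^ d - 1) / p` -/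
  N : ℕ
  /-- the generator of the Galois group -/
  δ : Ω ≃ₐ[K] Ω
  prim : IsPrimitiveRoot ζ p
  mem : δ ∈ F.fixingSubgroup
  apply_ζ : δ ζ = ζ ^ k
  d_pos : 0 < d
  not_dvd : ¬ p ∣ d
  pow_d : k ^ d = 1 + p * N
  ne : ∀ i, 0 < i → i < d → ζ ^ k ^ i ≠ ζ
  gen : ∀ h ∈ F.fixingSubgroup, ∃ m : ℕ, h ζ = (δ ^ m) ζ
  exists_root : ∃ δ₀ ∈ F.fixingSubgroup, δ₀ ^ p = δ ∧ δ₀ ζ = ζ ^ k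

namespace KummerDatum

variable {K Ω : Type*} [Field K] [Field Ω] [Algebra K Ω] {F : IntermediateField K Ω} {p : ℕ}
  (D : KummerDatum F p)

/-- `x` is fixed by all automorphisms fixing `F` and `ζ`. -/
def Inv (x : Ω) : Prop := ∀ τ ∈ F.fixingSubgroup, τ D.ζ = D.ζ → τ x = x

variable {D}

lemma Inv.mul {x y : Ω} (hx : D.Inv x) (hy : D.Inv y) : D.Inv (x * y) := fun τ h1 h2 ↦ by
  rw [map_mul, hx τ h1 h2, hy τ h1 h2]

lemma Inv.pow {x : Ω} (hx : D.Inv x) (n : ℕ) : D.Inv (x ^ n) := fun τ h1 h2 ↦ by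
  rw [map_pow, hx τ h1 h2]

variable (D)

lemma inv_one : D.Inv 1 := fun τ _ _ ↦ map_one τ

lemma pow_apply_ζ (i : ℕ) : (D.δ ^ i) D.ζ = D.ζ ^ D.k ^ i := by
  induction i with
  | zero => simp
  | succ i ih => rw [pow_succ', AlgEquiv.mul_apply, ih, map_pow, D.apply_ζ]; ring

lemma pow_d_apply_ζ : (D.δ ^ D.d) D.ζ = D.ζ := by
  rw [pow_apply_ζ, D.pow_d, pow_add, pow_mul, D.prim.pow_eq_one, one_pow, pow_one, mul_one]

variable {D}

lemma Inv.pow_d_apply {x : Ω} (hx : D.Inv x) : (D.δ ^ D.d) x = x :=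
  hx _ (pow_mem D.mem _) D.pow_d_apply_ζ

section Normal

variable [Normal K F] [Normal K Ω]

lemma Inv.comm {x : Ω} (hx : D.Inv x) {τ : Ω ≃ₐ[K] Ω} (hτ : τ D.ζ = D.ζ) :
    τ (D.δ x) = D.δ (τ x) := by
  have hδ := D.mem
  rw [IntermediateField.mem_fixingSubgroup_iff] at hδ
  have h := hx (τ⁻¹ * D.δ⁻¹ * τ * D.δ) ?_ ?_
  · simp only [AlgEquiv.mul_apply] at h
    rw [AlgEquiv.aut_inv, AlgEquiv.symm_apply_eq, AlgEquiv.aut_inv, AlgEquiv.symm_apply_eq] at h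
    exact h
  · rw [IntermediateField.mem_fixingSubgroup_iff]
    intro z hz
    simp only [AlgEquiv.mul_apply]
    rw [hδ z hz, AlgEquiv.aut_inv, AlgEquiv.symm_apply_eq, AlgEquiv.aut_inv,
      AlgEquiv.symm_apply_eq, hδ _ (apply_mem_of_normal F τ hz)]
  · simp only [AlgEquiv.mul_apply]
    rw [AlgEquiv.aut_inv, AlgEquiv.symm_apply_eq, AlgEquiv.aut_inv, AlgEquiv.symm_apply_eq,
      D.apply_ζ, map_pow, hτ, D.apply_ζ]

lemma Inv.apply_δ {x : Ω} (hx : D.Inv x) : D.Inv (D.δ x) := fun τ h1 h2 ↦ by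
  rw [hx.comm h2, hx τ h1 h2]

lemma Inv.eigenProd {c : Ω} (hc : D.Inv c) (n : ℕ) : D.Inv (eigenProd D.δ D.k c n) := by
  induction n with
  | zero => exact D.inv_one
  | succ n ih => exact (hc.pow _).mul ih.apply_δ

lemma Inv.apply_eigenProd {c : Ω} (hc : D.Inv c) {τ : Ω ≃ₐ[K] Ω} (hτ : τ D.ζ = D.ζ)
    (hτc : τ c = c) (n : ℕ) : τ (_root_.eigenProd D.δ D.k c n) = _root_.eigenProd D.δ D.k c n := by
  induction n with
  | zero => exact map_one τ
  | succ n ih => rw [eigenProd_succ, map_mul, map_pow, hτc, (hc.eigenProd n).comm hτ, ih]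

end Normal

variable {c β : Ω}

lemma exists_eq_pow_mul (hp : p.Prime) {x y : Ω} (h : x ^ p = y ^ p) :
    ∃ s : ℕ, x = D.ζ ^ s * y := by
  have := NeZero.mk hp.ne_zero
  by_cases hy : y = 0
  · subst hy
    rw [zero_pow hp.ne_zero] at h
    exact ⟨0, by simpa using eq_zero_of_pow_eq_zero h⟩
  · obtain ⟨s, -, hs⟩ := D.prim.eq_pow_of_pow_eq_one (ξ := x / y) (by
      rw [div_pow, h, div_self (pow_ne_zero _ hy)])
    exact ⟨s, by rw [hs, div_mul_cancel₀ _ hy]⟩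

lemma root_ne_zero (hp : p.Prime) (hc0 : c ≠ 0) (hβ : β ^ p = _root_.eigenProd D.δ D.k c D.d) :
    β ≠ 0 := by
  rintro rfl
  rw [zero_pow hp.ne_zero] at hβ
  exact eigenProd_ne_zero _ _ hc0 _ hβ.symm

lemma apply_eigenProd_mul (hc : D.Inv c) :
    D.δ (_root_.eigenProd D.δ D.k c D.d) * c ^ D.k ^ D.d =
      _root_.eigenProd D.δ D.k c D.d ^ D.k * c := by
  have h := eigenProd_succ' D.δ D.k c D.d
  rw [eigenProd_succ, hc.pow_d_apply] at h
  rw [← h, mul_comm]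

lemma exists_apply_root (hp : p.Prime) (hc : D.Inv c) (hc0 : c ≠ 0)
    (hβ : β ^ p = _root_.eigenProd D.δ D.k c D.d) :
    ∃ s : ℕ, D.δ β * c ^ D.N = D.ζ ^ s * β ^ D.k := by
  refine exists_eq_pow_mul hp ?_
  have h := apply_eigenProd_mul hc
  rw [← hβ, D.pow_d] at h
  have : D.δ (β ^ p) * c ^ (p * D.N) = (β ^ p) ^ D.k :=
    mul_right_cancel₀ hc0 (by rw [← h]; ring)
  rw [mul_pow, ← map_pow, ← pow_mul, ← pow_mul, mul_comm D.N, this]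
  ring

lemma pow_apply_root_of {s : ℕ} (hs : D.δ β * c ^ D.N = D.ζ ^ s * β ^ D.k) (i : ℕ) :
    (D.δ ^ (i + 1)) β * _root_.eigenProd D.δ D.k c (i + 1) ^ D.N =
      D.ζ ^ (s * (i + 1) * D.k ^ i) * β ^ D.k ^ (i + 1) := by
  induction i with
  | zero => simpa [_root_.eigenProd] using hs
  | succ i ih =>
    have h1 := congrArg D.δ ih
    simp only [map_mul, map_pow, D.apply_ζ] at h1
    have h2 : (D.δ β) ^ D.k ^ (i + 1) * c ^ (D.N * D.k ^ (i + 1)) =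
        D.ζ ^ (s * D.k ^ (i + 1)) * β ^ D.k ^ (i + 1 + 1) := by
      have := congrArg (· ^ D.k ^ (i + 1)) hs
      simp only [mul_pow, ← pow_mul] at this
      rw [this, pow_succ' _ (i + 1)]
    rw [eigenProd_succ, mul_pow, pow_succ' D.δ (i + 1), AlgEquiv.mul_apply]
    calc _ = (D.δ ((D.δ ^ (i + 1)) β) * D.δ (_root_.eigenProd D.δ D.k c (i + 1)) ^ D.N) *
          c ^ (D.N * D.k ^ (i + 1)) := by ring
      _ = _ := by
        rw [h1, mul_assoc, h2, ← pow_mul, ← mul_assoc, ← pow_add]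
        congr 2
        ring

lemma pow_d_apply_root (hp : p.Prime) (hc : D.Inv c) (hβ : β ^ p = _root_.eigenProd D.δ D.k c D.d)
    [Normal K F] [Normal K Ω] : (D.δ ^ D.d) β = β := by
  obtain ⟨δ₀, hmem, hroot, hζ⟩ := D.exists_root
  have hζd : (δ₀ ^ D.d) D.ζ = D.ζ := by
    have : ∀ i, (δ₀ ^ i) D.ζ = D.ζ ^ D.k ^ i := fun i ↦ by
      induction i with
      | zero => simp
      | succ i ih => rw [pow_succ', AlgEquiv.mul_apply, ih, map_pow, hζ]; ring
    rw [this, ← D.pow_apply_ζ, D.pow_d_apply_ζ]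
  obtain ⟨s, hs⟩ := exists_eq_pow_mul (D := D) hp (x := (δ₀ ^ D.d) β) (y := β) (by
    rw [← map_pow, hβ, hc.eigenProd _ _ (pow_mem hmem _) hζd])
  have key : ∀ i : ℕ, ((δ₀ ^ D.d) ^ i) β = D.ζ ^ (s * i) * β := fun i ↦ by
    induction i with
    | zero => simp
    | succ i ih => rw [pow_succ', AlgEquiv.mul_apply, ih, map_mul, map_pow, hζd, hs]; ring
  rw [← hroot, ← pow_mul, mul_comm, pow_mul, key, mul_comm s, pow_mul, D.prim.pow_eq_one, one_pow,
    one_mul]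

lemma pow_apply_root (hp : p.Prime) (hc : D.Inv c) (hc0 : c ≠ 0)
    (hβ : β ^ p = _root_.eigenProd D.δ D.k c D.d) [Normal K F] [Normal K Ω] (i : ℕ) :
    (D.δ ^ i) β * _root_.eigenProd D.δ D.k c i ^ D.N = β ^ D.k ^ i := by
  obtain ⟨s, hs⟩ := exists_apply_root hp hc hc0 hβ
  have hβ0 := root_ne_zero hp hc0 hβ
  have hd : D.d - 1 + 1 = D.d := Nat.sub_add_cancel D.d_pos
  have h := pow_apply_root_of hs (D.d - 1)
  have hcast : s * (D.d - 1 + 1) * D.k ^ (D.d - 1) = s * D.d * D.k ^ (D.d - 1) := by rw [hd]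
  rw [hcast, hd, pow_d_apply_root hp hc hβ, ← hβ, ← pow_mul, D.pow_d, pow_add, pow_one] at h
  have h1 : D.ζ ^ (s * D.d * D.k ^ (D.d - 1)) = 1 := by
    have hne : β * β ^ (p * D.N) ≠ 0 := mul_ne_zero hβ0 (pow_ne_zero _ hβ0)
    exact mul_right_cancel₀ hne (by rw [one_mul]; exact h.symm)
  have hdvd := (D.prim.pow_eq_one_iff_dvd _).1 h1
  have hs0 : D.ζ ^ s = 1 := by
    refine (D.prim.pow_eq_one_iff_dvd _).2 ?_
    rcases hp.dvd_mul.1 hdvd with h2 | h2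
    · exact (hp.dvd_mul.1 h2).resolve_right D.not_dvd
    · exfalso
      have h3 : p ∣ D.k ^ D.d := by rw [← hd, pow_succ]; exact h2.mul_right _
      rw [D.pow_d] at h3
      exact hp.one_lt.ne' (Nat.dvd_one.1 ((Nat.dvd_add_left (Dvd.intro _ rfl)).1 h3))
  cases i with
  | zero => simp [_root_.eigenProd]
  | succ i => rw [pow_apply_root_of hs i, mul_assoc s, pow_mul, hs0, one_pow, one_mul]

lemma apply_pow_apply_root (hp : p.Prime) (hc : D.Inv c) (hc0 : c ≠ 0)
    (hβ : β ^ p = _root_.eigenProd D.δ D.k c D.d)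
    [Normal K F] [Normal K Ω] {τ : Ω ≃ₐ[K] Ω} (hτ : τ D.ζ = D.ζ)
    (hτc : τ c = c) {r : ℕ} (hr : τ β = D.ζ ^ r * β) (i : ℕ) :
    τ ((D.δ ^ i) β) = (D.δ ^ i) (D.ζ ^ r * β) := by
  have h := pow_apply_root hp hc hc0 hβ i
  have h1 := congrArg τ h
  rw [map_mul, map_pow, hc.apply_eigenProd hτ hτc, map_pow, hr, mul_pow, ← h, ← mul_assoc] at h1
  have h2 := mul_right_cancel₀ (pow_ne_zero _ (eigenProd_ne_zero _ _ hc0 _)) h1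
  rw [h2, map_mul, map_pow, D.pow_apply_ζ]
  ring

variable (D) in
/-- The traces of `ζ ^ j * β` along the powers of `δ`. -/
def tr (β : Ω) (j : ℕ) : Ω := ∑ i ∈ Finset.range D.d, (D.δ ^ i) (D.ζ ^ j * β)

lemma apply_tr (hp : p.Prime) (hc : D.Inv c) (hc0 : c ≠ 0)
    (hβ : β ^ p = _root_.eigenProd D.δ D.k c D.d)
    [Normal K F] [Normal K Ω] {τ : Ω ≃ₐ[K] Ω} (hτ : τ D.ζ = D.ζ)
    (hτc : τ c = c) {r : ℕ} (hr : τ β = D.ζ ^ r * β) (j : ℕ) :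
    τ (D.tr β j) = D.tr β (j + r) := by
  rw [tr, map_sum, tr]
  refine Finset.sum_congr rfl fun i _ ↦ ?_
  rw [map_mul, map_mul, apply_pow_apply_root hp hc hc0 hβ hτ hτc hr, map_pow, D.pow_apply_ζ,
    map_pow, map_pow, hτ, pow_add, mul_assoc, map_mul _ (D.ζ ^ j), map_pow, D.pow_apply_ζ]

lemma δ_apply_tr (hp : p.Prime) (hc : D.Inv c) (hβ : β ^ p = _root_.eigenProd D.δ D.k c D.d)
    [Normal K F] [Normal K Ω] (j : ℕ) : D.δ (D.tr β j) = D.tr β j := by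
  have h : (D.δ ^ D.d) (D.ζ ^ j * β) = D.ζ ^ j * β := by
    rw [map_mul, map_pow, D.pow_d_apply_ζ, pow_d_apply_root hp hc hβ]
  have h1 := Finset.sum_range_succ (fun i ↦ (D.δ ^ i) (D.ζ ^ j * β)) D.d
  rw [Finset.sum_range_succ', h] at h1
  have h2 := add_right_cancel h1
  rw [tr, map_sum, ← h2]
  exact Finset.sum_congr rfl fun i _ ↦ by rw [pow_succ', AlgEquiv.mul_apply]

lemma fixing_pow_apply_tr (hp : p.Prime) (hc : D.Inv c) (hc0 : c ≠ 0)
    (hβ : β ^ p = _root_.eigenProd D.δ D.k c D.d)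
    [Normal K F] [Normal K Ω] {h : Ω ≃ₐ[K] Ω} (hh : h ∈ F.fixingSubgroup)
    (j : ℕ) : (h ^ p) (D.tr β j) = D.tr β j := by
  obtain ⟨m, hm⟩ := D.gen h hh
  set g := (D.δ ^ m)⁻¹ * h with hg
  have hgmem : g ∈ F.fixingSubgroup := mul_mem (inv_mem (pow_mem D.mem _)) hh
  have hgζ : g D.ζ = D.ζ := by
    rw [hg, AlgEquiv.mul_apply, AlgEquiv.aut_inv, AlgEquiv.symm_apply_eq, hm]
  obtain ⟨r, hr⟩ := exists_eq_pow_mul (D := D) hp (x := g β) (y := β) (by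
    rw [← map_pow, hβ, hc.eigenProd _ _ hgmem hgζ])
  have hδm : ∀ m j, (D.δ ^ m) (D.tr β j) = D.tr β j := fun m j ↦ by
    induction m with
    | zero => simp
    | succ m ih => rw [pow_succ', AlgEquiv.mul_apply, ih, δ_apply_tr hp hc hβ]
  have hhj : ∀ j, h (D.tr β j) = D.tr β (j + r) := fun j ↦ by
    rw [show h = D.δ ^ m * g by rw [hg]; group, AlgEquiv.mul_apply,
      apply_tr hp hc hc0 hβ hgζ (hc g hgmem hgζ) hr, hδm]
  have hpow : ∀ i j, (h ^ i) (D.tr β j) = D.tr β (j + i * r) := fun i j ↦ by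
    induction i with
    | zero => simp
    | succ i ih => rw [pow_succ', AlgEquiv.mul_apply, ih, hhj]; congr 1; ring
  rw [hpow, tr, tr]
  refine Finset.sum_congr rfl fun i _ ↦ ?_
  rw [pow_add, pow_mul, D.prim.pow_eq_one, one_pow, mul_one]

end KummerDatum

section Valuation

variable {R Γ : Type*} [CommRing R] [LinearOrderedCommGroupWithZero Γ] (v : Valuation R Γ) {g : Γ}

lemma Valuation.map_mul_sub_one_lt {x y : R} (hg : g ≤ 1) (hx : v (x - 1) < g)
    (hy : v (y - 1) < g) : v (x * y - 1) < g := by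
  rw [show x * y - 1 = (x - 1) * (y - 1) + ((x - 1) + (y - 1)) by ring]
  refine v.map_add_lt ?_ (v.map_add_lt hx hy)
  rw [map_mul]
  exact (mul_le_of_le_one_left' (hx.le.trans hg)).trans_lt hy

lemma Valuation.map_pow_sub_one_lt {x : R} (hg0 : 0 < g) (hg : g ≤ 1) (hx : v (x - 1) < g) (n : ℕ) :
    v (x ^ n - 1) < g := by
  induction n with
  | zero => simpa using hg0
  | succ n ih => rw [pow_succ]; exact v.map_mul_sub_one_lt hg ih hx

lemma Valuation.map_eq_one_of_sub_one_lt {x : R} (hx : v (x - 1) < 1) : v x = 1 := by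
  have := v.map_one_add_of_lt hx
  rwa [add_sub_cancel] at this

lemma Valuation.map_pow_sub_pow_lt {x y : R} (hx : v x ≤ 1) (hy : v y ≤ 1)
    (h : v (x - y) < g) (n : ℕ) : v (x ^ n - y ^ n) < g := by
  rw [← Commute.mul_geom_sum₂ (Commute.all x y), map_mul]
  refine (mul_le_of_le_one_right' ?_).trans_lt h
  refine v.map_sum_le fun i _ ↦ ?_
  rw [map_mul, map_pow, map_pow]
  exact mul_le_one' (pow_le_one' hx _) (pow_le_one' hy _)

end Valuation

lemma Valuation.map_rootOfUnity {Ω Γ : Type*} [Field Ω] [LinearOrderedCommGroupWithZero Γ]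
    (v : Valuation Ω Γ) {ζ : Ω} {n : ℕ} (hn : n ≠ 0) (h : ζ ^ n = 1) : v ζ = 1 := by
  have := congrArg v h
  rw [map_pow, map_one] at this
  exact (pow_eq_one_iff_of_nonneg zero_le hn).1 this

/-- The valuation of `p` is at most that of `1 - ξ` for a nontrivial `p`-th root of unity `ξ`. -/
lemma Valuation.map_natCast_le_of_pow_eq_one {Ω Γ : Type*} [Field Ω]
    [LinearOrderedCommGroupWithZero Γ] (v : Valuation Ω Γ) {ξ : Ω} {p : ℕ} (hp : p ≠ 0)
    (h : ξ ^ p = 1) (h1 : ξ ≠ 1) : v p ≤ v (ξ - 1) := by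
  have hsum : ∑ j ∈ Finset.range p, ξ ^ j = 0 := by
    have := mul_geom_sum ξ p
    rw [h, sub_self] at this
    exact (mul_eq_zero.1 this).resolve_left (sub_ne_zero.2 h1)
  have : (p : Ω) = ∑ j ∈ Finset.range p, (1 - ξ ^ j) := by
    rw [Finset.sum_sub_distrib, hsum, Finset.sum_const, Finset.card_range, nsmul_one, sub_zero]
  rw [this]
  refine v.map_sum_le fun j _ ↦ ?_
  rw [v.map_sub_swap, ← mul_geom_sum, map_mul]
  refine mul_le_of_le_one_right' (v.map_sum_le fun i _ ↦ ?_)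
  rw [map_pow, v.map_rootOfUnity hp h, one_pow]

/-- An element whose `p`-th power is close to `1` is close to a `p`-th root of unity. -/
lemma Valuation.exists_sub_pow_lt {Ω Γ : Type*} [Field Ω]
    [LinearOrderedCommGroupWithZero Γ] (v : Valuation Ω Γ) {ζ β : Ω} {p : ℕ} (hp : 0 < p)
    (hζ : IsPrimitiveRoot ζ p) {g : Γ} (h : v (β ^ p - 1) < g ^ p) :
    ∃ i : ℕ, v (β - ζ ^ i) < g := by
  have := NeZero.of_pos hp
  by_contra! hcon
  refine h.not_ge ?_
  rw [← one_pow p, hζ.pow_sub_pow_eq_prod_sub_mul _ _ hp, map_prod]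
  calc g ^ p = ∏ _x ∈ Polynomial.nthRootsFinset p (1 : Ω), g := by
        rw [Finset.prod_const, hζ.card_nthRootsFinset]
    _ ≤ _ := Finset.prod_le_prod' fun ξ hξ ↦ by
        obtain ⟨i, -, rfl⟩ := hζ.eq_pow_of_pow_eq_one ((Polynomial.mem_nthRootsFinset hp _).1 hξ)
        rw [mul_one]
        exact hcon i

lemma ValuationSubring.valuation_apply_lt {K Ω : Type*} [Field K] [Field Ω] [Algebra K Ω]
    (V : ValuationSubring Ω) (F : IntermediateField K Ω) {σ : Ω ≃ₐ[K] Ω}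
    (hV : ∀ x ∈ F, (σ x ∈ V ↔ x ∈ V)) {x : Ω} (hx : x ∈ F) {a : K} (ha : a ≠ 0)
    (h : V.valuation x < V.valuation (algebraMap K Ω a)) :
    V.valuation (σ x) < V.valuation (algebraMap K Ω a) := by
  have ha' : V.valuation (algebraMap K Ω a) ≠ 0 := by simpa using ha
  by_cases hx0 : x = 0
  · subst hx0
    simpa [zero_lt_iff] using ha
  have hmem := hV (x⁻¹ * algebraMap K Ω a) (F.mul_mem (F.inv_mem hx) (F.algebraMap_mem a))
  rw [← V.valuation_le_one_iff, ← V.valuation_le_one_iff, map_mul, map_mul, map_inv₀, map_mul,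
    AlgEquiv.commutes, map_inv₀, map_inv₀] at hmem
  have hx' : 0 < V.valuation x := zero_lt_iff.2 (by simpa using hx0)
  have hσx' : 0 < V.valuation (σ x) := zero_lt_iff.2 (by simpa using hx0)
  rw [← not_le] at h ⊢
  rw [inv_mul_le_one₀ hσx', inv_mul_le_one₀ hx'] at hmem
  rwa [hmem]

namespace KummerDatum

variable {K Ω : Type*} [Field K] [Field Ω] [Algebra K Ω] {F : IntermediateField K Ω} {p : ℕ}
  (D : KummerDatum F p)

lemma tr_one (m : ℕ) : D.tr 1 m = ∑ i ∈ Finset.range D.d, D.ζ ^ (m * D.k ^ i) := by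
  refine Finset.sum_congr rfl fun i _ ↦ ?_
  rw [mul_one, map_pow, D.pow_apply_ζ, ← pow_mul, mul_comm]

lemma sum_tr_one (hp : p.Prime) (m : ℕ) :
    ∑ j ∈ Finset.range p, D.ζ ^ ((p - 1) * j) * D.tr 1 (j + m) = p * D.ζ ^ m := by
  simp only [tr_one, Finset.mul_sum]
  rw [Finset.sum_comm]
  have hterm (i : ℕ) : ∑ j ∈ Finset.range p, D.ζ ^ ((p - 1) * j) * D.ζ ^ ((j + m) * D.k ^ i) =
      D.ζ ^ (m * D.k ^ i) * ∑ j ∈ Finset.range p, (D.ζ ^ (p - 1 + D.k ^ i)) ^ j := by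
    rw [Finset.mul_sum]
    exact Finset.sum_congr rfl fun j _ ↦ by ring
  have hζ : D.ζ ^ (p - 1) * D.ζ = 1 := by
    rw [← pow_succ, Nat.sub_add_cancel hp.one_le, D.prim.pow_eq_one]
  rw [Finset.sum_congr rfl fun i _ ↦ hterm i,
    Finset.sum_eq_single_of_mem 0 (Finset.mem_range.2 D.d_pos)]
  · rw [pow_zero, pow_succ, hζ]
    simp [mul_comm]
  · intro i hi hi0
    have h1 : D.ζ ^ (p - 1 + D.k ^ i) ≠ 1 := by
      rw [pow_add]
      intro h
      exact D.ne i (Nat.pos_of_ne_zero hi0) (Finset.mem_range.1 hi)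
        (mul_left_cancel₀ (left_ne_zero_of_mul_eq_one hζ) (h.trans hζ.symm))
    have := mul_geom_sum (D.ζ ^ (p - 1 + D.k ^ i)) p
    rw [← pow_mul, mul_comm (_ + _) p, pow_mul, D.prim.pow_eq_one, one_pow, sub_self] at this
    rw [(mul_eq_zero.1 this).resolve_left (sub_ne_zero.2 h1), mul_zero]

variable {D}

lemma map_ζ_pow (hp : p.Prime) {Γ : Type*} [LinearOrderedCommGroupWithZero Γ]
    (v : Valuation Ω Γ) (n : ℕ) : v (D.ζ ^ n) = 1 := by
  rw [map_pow, v.map_rootOfUnity hp.ne_zero D.prim.pow_eq_one, one_pow]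

variable [Normal K F] [Normal K Ω] {c β : Ω}

/-- If `c` and its conjugates are close to `1`, the traces of a `p`-th root of `eigenProd c` are
close to traces of `p`-th roots of unity. -/
lemma exists_map_tr_sub_lt (hp : p.Prime) (hc : D.Inv c) (hc0 : c ≠ 0)
    (hβ : β ^ p = _root_.eigenProd D.δ D.k c D.d)
    {Γ : Type*} [LinearOrderedCommGroupWithZero Γ] (v : Valuation Ω Γ) {P : Γ} (hP0 : 0 < P)
    (hP1 : P ≤ 1) (hsmall : ∀ i, v ((D.δ ^ i) c - 1) < P ^ (2 * p)) :
    ∃ i₀, ∀ j, v (D.tr β j - D.tr 1 (j + i₀)) < P ^ 2 := by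
  have hT (n : ℕ) : v (_root_.eigenProd D.δ D.k c n - 1) < P ^ (2 * p) := by
    induction n with
    | zero => simpa [_root_.eigenProd] using pow_pos hP0 _
    | succ n ih =>
      rw [eigenProd_succ']
      exact v.map_mul_sub_one_lt (pow_le_one' hP1 _)
        (v.map_pow_sub_one_lt (pow_pos hP0 _) (pow_le_one' hP1 _) ih _) (hsmall n)
  have hPle : P ^ (2 * p) ≤ P ^ 2 := pow_le_pow_right_of_le_one' hP1 (by have := hp.pos; omega)
  have hP2 : P ^ 2 ≤ 1 := pow_le_one' hP1 _
  obtain ⟨i₀, hi₀⟩ := v.exists_sub_pow_lt (g := P ^ 2) hp.pos D.prim (β := β) (by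
    rw [hβ, ← pow_mul]; exact hT _)
  have hβ1 : v β = 1 := by
    have h2 := v.map_add_eq_of_lt_right (x := β - D.ζ ^ i₀) (y := D.ζ ^ i₀)
      (by rw [map_ζ_pow hp]; exact hi₀.trans_le hP2)
    rwa [sub_add_cancel, map_ζ_pow hp] at h2
  have hδβ (i : ℕ) : v ((D.δ ^ i) β - D.ζ ^ (i₀ * D.k ^ i)) < P ^ 2 := by
    have h := pow_apply_root hp hc hc0 hβ i
    have hTN := v.map_pow_sub_one_lt (pow_pos hP0 _) (pow_le_one' hP1 _) (hT i) D.N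
    have hTN1 := v.map_eq_one_of_sub_one_lt (hTN.trans_le (hPle.trans hP2))
    have hδ1 : v ((D.δ ^ i) β) = 1 := by
      have := congrArg v h
      rwa [map_mul, hTN1, mul_one, map_pow, hβ1, one_pow] at this
    have h3 := v.map_pow_sub_pow_lt hβ1.le (map_ζ_pow hp v i₀).le hi₀ (D.k ^ i)
    rw [← h, ← pow_mul] at h3
    have h4 : v ((D.δ ^ i) β * (_root_.eigenProd D.δ D.k c i ^ D.N - 1)) < P ^ 2 := by
      rw [map_mul, hδ1, one_mul]
      exact hTN.trans_le hPle
    have h5 := v.map_sub_lt h3 h4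
    rwa [mul_sub, mul_one, sub_sub_sub_comm, sub_self, zero_sub, neg_sub] at h5
  refine ⟨i₀, fun j ↦ ?_⟩
  rw [tr_one, tr, ← Finset.sum_sub_distrib]
  refine v.map_sum_lt (pow_pos hP0 _).ne' fun i _ ↦ ?_
  rw [map_mul, map_pow, D.pow_apply_ζ, ← pow_mul, add_mul, pow_add, mul_comm (D.k ^ i),
    ← mul_sub, map_mul, map_ζ_pow hp, one_mul]
  exact hδβ i

lemma tr_mem (hp : p.Prime) (hc : D.Inv c) (hc0 : c ≠ 0)
    (hβ : β ^ p = _root_.eigenProd D.δ D.k c D.d)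
    (hF : ∀ y : Ω, IsSeparable K y → (∀ h ∈ F.fixingSubgroup, (h ^ p) y = y) → y ∈ F)
    (hζsep : IsSeparable K D.ζ) (hβsep : IsSeparable K β) (j : ℕ) : D.tr β j ∈ F := by
  refine hF _ ?_ fun h hh ↦ fixing_pow_apply_tr hp hc hc0 hβ hh j
  have hb' : β ∈ separableClosure K Ω := mem_separableClosure_iff.2 hβsep
  have hζ' : D.ζ ∈ separableClosure K Ω := mem_separableClosure_iff.2 hζsep
  refine mem_separableClosure_iff.1 (sum_mem fun i _ ↦ mem_separableClosure_iff.2 ?_)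
  exact isSeparable_algEquiv_apply _ (mem_separableClosure_iff.1
    ((separableClosure K Ω).mul_mem (pow_mem hζ' _) hb'))

/-- A `p`-th root of an eigenelement close to `1` is fixed by `σ` as soon as `σ` is continuous
on `F`. -/
lemma apply_root_eq (hp : p.Prime) (hc : D.Inv c) (hc0 : c ≠ 0)
    (hβ : β ^ p = _root_.eigenProd D.δ D.k c D.d)
    (hF : ∀ y : Ω, IsSeparable K y → (∀ h ∈ F.fixingSubgroup, (h ^ p) y = y) → y ∈ F)
    (hζsep : IsSeparable K D.ζ) (hβsep : IsSeparable K β)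
    {σ : Ω ≃ₐ[K] Ω} (hσζ : σ D.ζ = D.ζ) (hσc : σ c = c)
    {Γ : Type*} [LinearOrderedCommGroupWithZero Γ] (v : Valuation Ω Γ) {P : Γ} (hP0 : 0 < P)
    (hP1 : P ≤ 1) (hP : v (p : Ω) = P) (hv : ∀ x ∈ F, v x < P ^ 2 → v (σ x) < P ^ 2)
    (hsmall : ∀ i, v ((D.δ ^ i) c - 1) < P ^ (2 * p)) : σ β = β := by
  have hone : (1 : Ω) ^ p = _root_.eigenProd D.δ D.k 1 D.d := by rw [eigenProd_one, one_pow]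
  have htrβ (j : ℕ) : D.tr β j ∈ F := tr_mem hp hc hc0 hβ hF hζsep hβsep j
  have htr1 (j : ℕ) : D.tr 1 j ∈ F :=
    tr_mem hp D.inv_one one_ne_zero hone hF hζsep
      (map_one (algebraMap K Ω) ▸ isSeparable_algebraMap (1 : K)) j
  obtain ⟨i₀, hdiff⟩ := exists_map_tr_sub_lt hp hc hc0 hβ v hP0 hP1 hsmall
  obtain ⟨r, hr⟩ := exists_eq_pow_mul (D := D) hp (x := σ β) (y := β) (by
    rw [← map_pow, hβ, hc.apply_eigenProd hσζ hσc])
  have hshift (m : ℕ) : v (D.tr 1 (m + (r + i₀)) - D.tr 1 (m + i₀)) < P ^ 2 := by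
    have h1 := hv _ (sub_mem (htrβ m) (htr1 (m + i₀))) (hdiff m)
    rw [map_sub, apply_tr hp hc hc0 hβ hσζ hσc hr,
      apply_tr hp D.inv_one one_ne_zero hone hσζ (map_one σ) (r := 0) (by simp), add_zero] at h1
    have h2 := v.map_sub_lt h1 (hdiff (m + r))
    rw [sub_sub_sub_cancel_left, add_assoc] at h2
    exact h2
  have hfin : v ((p : Ω) * D.ζ ^ (r + i₀) - p * D.ζ ^ i₀) < P ^ 2 := by
    rw [← D.sum_tr_one hp, ← D.sum_tr_one hp, ← Finset.sum_sub_distrib]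
    refine v.map_sum_lt (pow_pos hP0 _).ne' fun j _ ↦ ?_
    rw [← mul_sub, map_mul, map_ζ_pow hp, one_mul]
    exact hshift j
  rw [← mul_sub, pow_add, show D.ζ ^ r * D.ζ ^ i₀ - D.ζ ^ i₀ = (D.ζ ^ r - 1) * D.ζ ^ i₀ by ring,
    map_mul, map_mul, map_ζ_pow hp, mul_one, pow_two, hP] at hfin
  have hlt : v (D.ζ ^ r - 1) < P := lt_of_mul_lt_mul_left' hfin
  by_cases h1 : D.ζ ^ r = 1
  · rw [hr, h1, one_mul]
  · refine absurd hlt (not_lt.2 (hP ▸ v.map_natCast_le_of_pow_eq_one hp.ne_zero ?_ h1))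
    rw [← pow_mul, mul_comm, pow_mul, D.prim.pow_eq_one, one_pow]

end KummerDatum

/-- Kummer data exist in characteristic different from `p`. -/
lemma exists_kummerDatum {K Ω : Type*} [Field K] [Field Ω] [Algebra K Ω] [IsAlgClosed Ω]
    (F : IntermediateField K Ω) {p : ℕ} (hp : p.Prime) (hpΩ : (p : Ω) ≠ 0) :
    Nonempty (KummerDatum F p) := by
  have := Fact.mk hp
  have := NeZero.mk hpΩ
  obtain ⟨ζ, hζ⟩ := HasEnoughRootsOfUnity.exists_primitiveRoot Ω p
  let χ := hζ.autToPow K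
  have hχ (f : Ω ≃ₐ[K] Ω) : ζ ^ ((χ f : ZMod p).val) = f ζ := hζ.autToPow_spec K f
  obtain ⟨⟨g, δ₀, hδ₀, hg⟩, hgen⟩ := IsCyclic.exists_generator
    (α := F.fixingSubgroup.map χ)
  have hgp : χ (δ₀ ^ p) = g := by
    ext
    rw [map_pow, hg, Units.val_pow_eq_pow_val, ZMod.pow_card]
  have hcast : (((g : ZMod p).val : ℕ) : ZMod p) = g := by simp
  have hζinj (m n : ℕ) : ζ ^ m = ζ ^ n ↔ (m : ZMod p) = n := by
    have hu : IsPrimitiveRoot (Units.mk0 ζ (hζ.ne_zero hp.ne_zero)) p :=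
      IsPrimitiveRoot.coe_units_iff.1 hζ
    rw [ZMod.natCast_eq_natCast_iff, hu.eq_orderOf, ← pow_eq_pow_iff_modEq, ← Units.val_inj]
    rfl
  have hd : orderOf g ∣ p - 1 := by
    rw [← ZMod.card_units p]
    exact orderOf_dvd_card
  have hp1 : 0 < p - 1 := Nat.sub_pos_of_lt hp.one_lt
  have hmod : p ∣ (g : ZMod p).val ^ orderOf g - 1 := by
    rw [← (Nat.modEq_iff_dvd' (Nat.one_le_pow _ _ (Nat.pos_of_ne_zero ?_))),
      ← ZMod.natCast_eq_natCast_iff]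
    · rw [Nat.cast_pow, hcast, ← Units.val_pow_eq_pow_val, pow_orderOf_eq_one]
      simp
    · simp [ZMod.val_eq_zero]
  obtain ⟨N, hN⟩ := hmod
  refine ⟨⟨ζ, (g : ZMod p).val, orderOf g, N, δ₀ ^ p, hζ, pow_mem hδ₀ _, ?_, orderOf_pos g, ?_, ?_,
    ?_, ?_, δ₀, hδ₀, rfl, ?_⟩⟩
  · rw [← hχ, hgp]
  · exact fun h ↦ by have := Nat.le_of_dvd hp1 (h.trans hd); omega
  · rw [← hN]
    have : 1 ≤ (g : ZMod p).val ^ orderOf g := Nat.one_le_pow _ _ (Nat.pos_of_ne_zero (by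
      simp [ZMod.val_eq_zero]))
    omega
  · intro i hi0 hi h
    nth_rw 2 [← pow_one ζ] at h
    rw [hζinj, Nat.cast_pow, hcast, ← Units.val_pow_eq_pow_val, Nat.cast_one,
      Units.val_eq_one] at h
    exact (Nat.le_of_dvd hi0 (orderOf_dvd_of_pow_eq_one h)).not_gt hi
  · intro h hh
    have := mem_powers_iff_mem_zpowers.2 (hgen ⟨χ h, Subgroup.mem_map_of_mem _ hh⟩)
    obtain ⟨m, hm⟩ := this
    have hm' : g ^ m = χ h := congrArg Subtype.val hm
    exact ⟨m, by rw [← hχ, ← hχ, map_pow, hgp, hm']⟩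
  · rw [← hχ, hg]

/-- Valuation rings extend along field homomorphisms. -/
lemma ValuationSubring.exists_comap_eq {K L : Type*} [Field K] [Field L] (φ : K →+* L)
    (O : ValuationSubring K) : ∃ V : ValuationSubring L, V.comap φ = O := by
  obtain ⟨V, h, hV⟩ := IsLocalRing.exists_factor_valuationRing (φ.comp (algebraMap O K))
  refine ⟨V, ?_⟩
  ext x
  rw [mem_comap]
  refine ⟨fun hx ↦ ?_, fun hx ↦ h ⟨x, hx⟩⟩
  rcases O.mem_or_inv_mem x with hx' | hx'
  · exact hx'
  by_cases hx0 : x = 0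
  · exact hx0 ▸ O.zero_mem
  have hu : IsUnit (⟨x⁻¹, hx'⟩ : O) := by
    refine hV.map_nonunit _ (.of_mul_eq_one ⟨φ x, hx⟩ (Subtype.ext ?_))
    change φ x⁻¹ * φ x = 1
    rw [← map_mul, inv_mul_cancel₀ hx0, map_one]
  obtain ⟨⟨y, hy⟩, hxy⟩ := hu.exists_right_inv
  have : x⁻¹ * y = 1 := congrArg Subtype.val hxy
  rwa [← inv_inv x, inv_eq_of_mul_eq_one_right this]

/-- A `(p,q)`-henselian valuation extends to a valuation of the algebraic closure whose
restriction to `K(p,q)` is Galois invariant. -/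
lemma IsPQHenselian.exists_extension {p q : ℕ} {K : Type*} [Field K] {O : ValuationSubring K}
    (h : IsPQHenselian p q O) : ∃ V : ValuationSubring (AlgebraicClosure K),
      V.comap (algebraMap K (AlgebraicClosure K)) = O ∧
      ∀ (σ : Gal(AlgebraicClosure K/K)), ∀ x ∈ maxPQExt p q K (AlgebraicClosure K),
        (σ x ∈ V ↔ x ∈ V) := by
  set F := maxPQExt p q K (AlgebraicClosure K)
  obtain ⟨O', hO', huniq⟩ := h
  obtain ⟨V, hV⟩ := ValuationSubring.exists_comap_eq (algebraMap F (AlgebraicClosure K)) O'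
  refine ⟨V, ?_, fun σ x hx ↦ ?_⟩
  · rw [← hO', ← hV, ValuationSubring.comap_comap, ← IsScalarTower.algebraMap_eq]
  · have h1 := huniq (O'.comap (σ.restrictNormal F : F →+* F)) (by
      beta_reduce
      rw [← hO', ValuationSubring.comap_comap]
      congr 1
      ext y
      exact congrArg Subtype.val ((σ.restrictNormal F).commutes y))
    have h2 : (σ.restrictNormal F) ⟨x, hx⟩ ∈ O' ↔ (⟨x, hx⟩ : F) ∈ O' := by
      conv_rhs => rw [← h1]
      rfl
    rw [← hV, ValuationSubring.mem_comap, ValuationSubring.mem_comap] at h2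
    rwa [AlgEquiv.restrictNormal_commutes] at h2

/-- Two independent valuation rings multiplicatively generate the field. -/
lemma ValuationSubring.exists_mul_eq {K : Type*} [Field K] {O₁ O₂ : ValuationSubring K}
    (h : O₁.toSubring ⊔ O₂.toSubring = ⊤) (z : K) : ∃ x ∈ O₁, ∃ y ∈ O₂, x * y = z := by
  let S : Subring K :=
    { carrier := {z | ∃ x ∈ O₁, ∃ y ∈ O₂, x * y = z}
      mul_mem' := by
        rintro _ _ ⟨x, hx, y, hy, rfl⟩ ⟨x', hx', y', hy', rfl⟩
        exact ⟨x * x', MulMemClass.mul_mem hx hx', y * y', MulMemClass.mul_mem hy hy', by ring⟩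
      one_mem' := ⟨1, one_mem _, 1, one_mem _, mul_one 1⟩
      zero_mem' := ⟨0, zero_mem _, 0, zero_mem _, mul_zero 0⟩
      neg_mem' := by
        rintro _ ⟨x, hx, y, hy, rfl⟩
        exact ⟨-x, NegMemClass.neg_mem hx, y, hy, by ring⟩
      add_mem' := by
        have key {x y x' y' : K} (hx : x ∈ O₁) (hy : y ∈ O₂) (hy' : y' ∈ O₂)
            (hx0 : x ≠ 0) (hs : x' / x ∈ O₁) : ∃ a ∈ O₁, ∃ b ∈ O₂, a * b = x * y + x' * y' := by
          rcases O₂.mem_or_inv_mem (x' / x) with hs2 | hs2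
          · exact ⟨x, hx, y + x' / x * y',
              AddMemClass.add_mem hy (MulMemClass.mul_mem hs2 hy'), by field_simp⟩
          · by_cases hx'0 : x' = 0
            · exact ⟨x, hx, y, hy, by simp [hx'0]⟩
            · exact ⟨x * (x' / x), MulMemClass.mul_mem hx hs, (x' / x)⁻¹ * y + y',
                AddMemClass.add_mem (MulMemClass.mul_mem hs2 hy) hy', by field_simp⟩
        rintro _ _ ⟨x, hx, y, hy, rfl⟩ ⟨x', hx', y', hy', rfl⟩
        by_cases hx0 : x = 0
        · exact ⟨x', hx', y', hy', by simp [hx0]⟩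
        by_cases hx'0 : x' = 0
        · exact ⟨x, hx, y, hy, by simp [hx'0]⟩
        rcases O₁.mem_or_inv_mem (x' / x) with hs | hs
        · exact key hx hy hy' hx0 hs
        · rw [inv_div] at hs
          obtain ⟨a, ha, b, hb, hab⟩ := key hx' hy' hy hx'0 hs
          exact ⟨a, ha, b, hb, by rw [hab, add_comm]⟩ }
  have hS : (⊤ : Subring K) ≤ S := by
    rw [← h]
    exact sup_le (fun x hx ↦ ⟨x, hx, 1, one_mem _, mul_one x⟩)
      (fun y hy ↦ ⟨1, one_mem _, y, hy, one_mul y⟩)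
  exact hS (Subring.mem_top z)

/-- Approximation for two independent valuations. -/
lemma ValuationSubring.exists_approx {K : Type*} [Field K] {O₁ O₂ : ValuationSubring K}
    (h : O₁.toSubring ⊔ O₂.toSubring = ⊤) {u₁ u₂ : K} (hu₁ : u₁ ≠ 0) (hu₂ : u₂ ≠ 0)
    (h₁ : O₁.valuation u₁ < 1) (h₂ : O₂.valuation u₂ < 1) :
    ∃ t : K, O₁.valuation t ≤ O₁.valuation u₁ ∧ O₂.valuation (1 - t) ≤ O₂.valuation u₂ := by
  obtain ⟨x, hx, y, hy, hxy⟩ := exists_mul_eq h (u₁ * u₂)⁻¹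
  have hw : (u₁ * x) * (u₂ * y) = 1 := by
    rw [mul_mul_mul_comm, hxy, mul_inv_cancel₀ (mul_ne_zero hu₁ hu₂)]
  have h3 : O₁.valuation (u₁ * x) ≤ O₁.valuation u₁ := by
    rw [map_mul]
    exact mul_le_of_le_one_right' ((O₁.valuation_le_one_iff x).2 hx)
  have h4 : O₂.valuation (u₂ * y) ≤ O₂.valuation u₂ := by
    rw [map_mul]
    exact mul_le_of_le_one_right' ((O₂.valuation_le_one_iff y).2 hy)
  have h5 := O₁.valuation.map_one_add_of_lt (h3.trans_lt h₁)
  have h6 := O₂.valuation.map_one_add_of_lt (h4.trans_lt h₂)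
  generalize u₁ * x = w at *
  generalize u₂ * y = w' at *
  have hw0 : 1 + w ≠ 0 := fun h0 ↦ by simp [h0] at h5
  have hw0' : 1 + w' ≠ 0 := fun h0 ↦ by simp [h0] at h6
  refine ⟨w / (1 + w), by rwa [map_div₀, h5, div_one], ?_⟩
  have : 1 - w / (1 + w) = w' / (1 + w') := by
    field_simp
    linear_combination -hw
  rwa [this, map_div₀, h6, div_one]

/-- Over a nontrivial valuation of `K`, there are elements of `K` smaller than any given nonzero
algebraic element. -/
lemma ValuationSubring.exists_forall_valuation_lt {K Ω : Type*} [Field K] [Field Ω] [Algebra K Ω]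
    [Algebra.IsAlgebraic K Ω] {O : ValuationSubring K} (hO : O ≠ ⊤) {V : ValuationSubring Ω}
    (hV : V.comap (algebraMap K Ω) = O) {r : Ω} (hr : r ≠ 0) :
    ∃ a : K, a ≠ 0 ∧ O.valuation a < 1 ∧ ∀ k : K, O.valuation k ≤ O.valuation a →
      V.valuation (algebraMap K Ω k) < V.valuation r := by
  have hOV (x : K) : algebraMap K Ω x ∈ V ↔ x ∈ O := by rw [← hV, mem_comap]
  let _ : Algebra O Ω := ((algebraMap K Ω).comp (algebraMap O K)).toAlgebra
  have : IsScalarTower O K Ω := .of_algebraMap_eq fun _ ↦ rfl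
  have halg : IsAlgebraic O r⁻¹ :=
    (IsFractionRing.isAlgebraic_iff O K Ω).2 (Algebra.IsAlgebraic.isAlgebraic r⁻¹)
  obtain ⟨y, hy0, hy⟩ := halg.exists_integral_multiple
  have hyV : algebraMap K Ω y * r⁻¹ ∈ V := by
    let φ : O →+* V := ((algebraMap K Ω).comp (algebraMap O K)).codRestrict V.toSubring
      fun x ↦ (hOV x).2 x.2
    let _ : Algebra O V := φ.toAlgebra
    have : IsScalarTower O V Ω := .of_algebraMap_eq fun _ ↦ rfl
    have h1 : IsIntegral V (y • r⁻¹) := hy.tower_top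
    obtain ⟨z, hz⟩ := (IsIntegrallyClosed.isIntegral_iff (R := V) (K := Ω)).1 h1
    rw [Algebra.smul_def] at hz
    exact hz ▸ z.2
  obtain ⟨x, hx⟩ : ∃ x, x ∉ O := by
    by_contra! h
    exact hO (_root_.eq_top_iff.2 fun x _ ↦ h x)
  have hx0 : x ≠ 0 := fun h ↦ hx (h ▸ O.zero_mem)
  have hy0' : (y : K) ≠ 0 := fun h ↦ hy0 (Subtype.ext h)
  have hx1 : O.valuation x⁻¹ < 1 := by
    rw [map_inv₀]
    exact inv_lt_one_of_one_lt₀ (not_le.1 fun h ↦ hx ((O.valuation_le_one_iff x).1 h))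
  refine ⟨y * x⁻¹, mul_ne_zero hy0' (inv_ne_zero hx0), ?_, fun k hk ↦ ?_⟩
  · rw [map_mul]
    exact (mul_le_of_le_one_left' (O.valuation_le_one y)).trans_lt hx1
  · have hr' : V.valuation r ≠ 0 := by simpa using hr
    have hyr : V.valuation (algebraMap K Ω y) ≤ V.valuation r := by
      rw [← V.valuation_le_one_iff, map_mul, map_inv₀] at hyV
      rwa [← div_eq_mul_inv, div_le_one₀ (zero_lt_iff.2 hr')] at hyV
    have hxV : V.valuation (algebraMap K Ω x⁻¹) < 1 := by
      rw [map_inv₀, map_inv₀]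
      exact inv_lt_one_of_one_lt₀ (not_le.1 fun h ↦ hx ((hOV x).1 ((V.valuation_le_one_iff _).1 h)))
    have hk' : k / (y * x⁻¹) ∈ O := by
      have : O.valuation (y * x⁻¹) ≠ 0 := by simp [hy0', hx0]
      rw [← O.valuation_le_one_iff, map_div₀, div_le_one₀ (zero_lt_iff.2 this)]
      exact hk
    have hk2 : V.valuation (algebraMap K Ω (k / (y * x⁻¹))) ≤ 1 :=
      (V.valuation_le_one_iff _).2 ((hOV _).2 hk')
    have hk3 : k = k / (y * x⁻¹) * y * x⁻¹ := by field_simp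
    rw [hk3, map_mul, map_mul, map_mul, map_mul]
    calc _ ≤ V.valuation r * V.valuation (algebraMap K Ω x⁻¹) :=
          mul_le_mul_left ((mul_le_of_le_one_left' hk2).trans hyr) _
      _ < V.valuation r := mul_lt_of_lt_one_right (zero_lt_iff.2 hr') hxV

/-- Simultaneous approximation in `K` for two valuations of an algebraic extension which are
independent on `K`. -/
lemma ValuationSubring.exists_valuation_lt_of_independent {K Ω : Type*} [Field K] [Field Ω]
    [Algebra K Ω] [Algebra.IsAlgebraic K Ω] {O₁ O₂ : ValuationSubring K} (h₁ : O₁ ≠ ⊤)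
    (h₂ : O₂ ≠ ⊤) (h : O₁.toSubring ⊔ O₂.toSubring = ⊤) {V₁ V₂ : ValuationSubring Ω}
    (hV₁ : V₁.comap (algebraMap K Ω) = O₁) (hV₂ : V₂.comap (algebraMap K Ω) = O₂)
    (r₁ r₂ : Ω) (hr₁ : r₁ ≠ 0) (hr₂ : r₂ ≠ 0) :
    ∃ t : K, V₁.valuation (algebraMap K Ω t) < V₁.valuation r₁ ∧
      V₂.valuation (1 - algebraMap K Ω t) < V₂.valuation r₂ := by
  obtain ⟨a₁, ha₁, hlt₁, H₁⟩ := exists_forall_valuation_lt h₁ hV₁ hr₁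
  obtain ⟨a₂, ha₂, hlt₂, H₂⟩ := exists_forall_valuation_lt h₂ hV₂ hr₂
  obtain ⟨t, ht₁, ht₂⟩ := exists_approx h ha₁ ha₂ hlt₁ hlt₂
  refine ⟨t, H₁ t ht₁, ?_⟩
  rw [← map_one (algebraMap K Ω), ← map_sub]
  exact H₂ _ ht₂

lemma Valuation.exists_forall_lt_le {Ω Γ : Type*} [Field Ω] [LinearOrderedCommGroupWithZero Γ]
    (v : Valuation Ω Γ) (f : ℕ → Ω) (n : ℕ) : ∃ M : Ω, M ≠ 0 ∧ ∀ i < n, v (f i) ≤ v M := by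
  induction n with
  | zero => exact ⟨1, one_ne_zero, by simp⟩
  | succ n ih =>
    obtain ⟨M, hM, h⟩ := ih
    rcases le_total (v (f n)) (v M) with hle | hle
    · refine ⟨M, hM, fun i hi ↦ ?_⟩
      rcases Nat.lt_succ_iff_lt_or_eq.1 hi with hi | rfl
      exacts [h i hi, hle]
    · refine ⟨f n, fun h0 ↦ ?_, fun i hi ↦ ?_⟩
      · rw [h0, map_zero, le_zero_iff, v.zero_iff] at hle
        exact hM hle
      · rcases Nat.lt_succ_iff_lt_or_eq.1 hi with hi | rfl
        exacts [(h i hi).trans hle, le_rfl]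

lemma KummerDatum.Inv.exists_orbit_le {K Ω : Type*} [Field K] [Field Ω] [Algebra K Ω]
    {F : IntermediateField K Ω} {p : ℕ} {D : KummerDatum F p} {z : Ω} (hz : D.Inv z)
    {Γ : Type*} [LinearOrderedCommGroupWithZero Γ] (v : Valuation Ω Γ) :
    ∃ M : Ω, M ≠ 0 ∧ ∀ i, v ((D.δ ^ i) z) ≤ v M := by
  obtain ⟨M, hM, h⟩ := v.exists_forall_lt_le (fun i ↦ (D.δ ^ i) z) D.d
  refine ⟨M, hM, fun i ↦ ?_⟩
  have hper (m : ℕ) : (D.δ ^ (D.d * m)) z = z := by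
    induction m with
    | zero => rfl
    | succ m ih => rw [mul_add, mul_one, pow_add, AlgEquiv.mul_apply, hz.pow_d_apply, ih]
  rw [← Nat.mod_add_div i D.d, pow_add, AlgEquiv.mul_apply, hper]
  exact h _ (Nat.mod_lt _ D.d_pos)

section Separable

variable {K S Ω : Type*} [Field K] [Field S] [Field Ω] [Algebra K S] [Algebra K Ω] [Algebra S Ω]
  [IsScalarTower K S Ω] [Algebra.IsSeparable K S]

lemma isSeparable_of_aeval_separable {f : Polynomial S} (hf : f.Separable) {x : Ω}
    (hx : Polynomial.aeval x f = 0) : IsSeparable K x :=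
  IsSeparable.of_algebra_isSeparable_of_isSeparable K
    (hf.of_dvd (minpoly.dvd S x hx) : IsSeparable S x)

lemma isSeparable_of_pow_eq_algebraMap {n : ℕ} (hn : (n : Ω) ≠ 0) {x : Ω} (hx0 : x ≠ 0) {s : S}
    (hx : x ^ n = algebraMap S Ω s) : IsSeparable K x := by
  have hn' : (n : S) ≠ 0 := fun h ↦ hn (by rw [← map_natCast (algebraMap S Ω), h, map_zero])
  have hs : s ≠ 0 := fun h ↦ pow_ne_zero n hx0 (by rw [hx, h, map_zero])
  exact isSeparable_of_aeval_separable (Polynomial.separable_X_pow_sub_C s hn' hs) (by simp [hx])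

lemma isSeparable_of_pow_sub_eq_algebraMap {n : ℕ} (hn : (n : Ω) = 0) {x : Ω} {s : S}
    (hx : x ^ n - x = algebraMap S Ω s) : IsSeparable K x := by
  refine isSeparable_of_aeval_separable (f := .X ^ n - .X - .C s) ?_ (by simp [hx])
  have : (n : S) = 0 := (algebraMap S Ω).injective (by rw [map_natCast, hn, map_zero])
  rw [Polynomial.separable_def']
  refine ⟨0, -1, ?_⟩
  rw [Polynomial.derivative_sub, Polynomial.derivative_sub, Polynomial.derivative_X_pow, this]
  simp

end Separable

lemma isSeparable_of_pow {K Ω : Type*} [Field K] [Field Ω] [Algebra K Ω] {n : ℕ}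
    (hn : (n : Ω) ≠ 0) {x : Ω} (hx0 : x ≠ 0) (hx : IsSeparable K (x ^ n)) : IsSeparable K x :=
  isSeparable_of_pow_eq_algebraMap (S := separableClosure K Ω) hn hx0
    (s := ⟨x ^ n, mem_separableClosure_iff.2 hx⟩) rfl

lemma isSeparable_of_pow_sub {K Ω : Type*} [Field K] [Field Ω] [Algebra K Ω] {n : ℕ}
    (hn : (n : Ω) = 0) {x : Ω} (hx : IsSeparable K (x ^ n - x)) : IsSeparable K x :=
  isSeparable_of_pow_sub_eq_algebraMap (S := separableClosure K Ω) hn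
    (s := ⟨x ^ n - x, mem_separableClosure_iff.2 hx⟩) rfl

lemma isSeparable_eigenProd {K Ω : Type*} [Field K] [Field Ω] [Algebra K Ω] (δ : Ω ≃ₐ[K] Ω)
    (k : ℕ) {c : Ω} (hc : IsSeparable K c) (n : ℕ) : IsSeparable K (eigenProd δ k c n) := by
  rw [← mem_separableClosure_iff] at *
  induction n with
  | zero => exact one_mem _
  | succ n ih =>
    exact mul_mem (pow_mem hc _) (mem_separableClosure_iff.2
      (isSeparable_algEquiv_apply δ (mem_separableClosure_iff.1 ih)))

lemma KummerDatum.eigenProd_ζ {K Ω : Type*} [Field K] [Field Ω] [Algebra K Ω]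
    {F : IntermediateField K Ω} {p : ℕ} (D : KummerDatum F p) (n : ℕ) :
    eigenProd D.δ D.k D.ζ (n + 1) = D.ζ ^ ((n + 1) * D.k ^ n) := by
  induction n with
  | zero => simp [eigenProd]
  | succ n ih =>
    rw [eigenProd_succ, ih, map_pow, D.apply_ζ]
    ring

namespace KummerDatum

variable {K Ω : Type*} [Field K] [Field Ω] [Algebra K Ω] {F : IntermediateField K Ω} {p : ℕ}
  {D : KummerDatum F p}

lemma isSeparable_ζ (hp : p.Prime) (hpΩ : (p : Ω) ≠ 0) : IsSeparable K D.ζ :=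
  isSeparable_of_pow hpΩ (D.prim.ne_zero hp.ne_zero)
    (D.prim.pow_eq_one ▸ mem_separableClosure_iff.1 (one_mem _))

variable [Normal K F] [Normal K Ω]

lemma apply_root_eq_of_invariant (hp : p.Prime) (hpΩ : (p : Ω) ≠ 0) {c β : Ω} (hc : D.Inv c)
    (hc0 : c ≠ 0) (hcsep : IsSeparable K c) (hβ : β ^ p = eigenProd D.δ D.k c D.d)
    (hF : ∀ y : Ω, IsSeparable K y → (∀ h ∈ F.fixingSubgroup, (h ^ p) y = y) → y ∈ F)
    {σ : Ω ≃ₐ[K] Ω} (hσζ : σ D.ζ = D.ζ) (hσc : σ c = c) (V : ValuationSubring Ω)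
    (hV : ∀ x ∈ F, (σ x ∈ V ↔ x ∈ V))
    (hsmall : ∀ i, V.valuation ((D.δ ^ i) c - 1) < V.valuation ((p : Ω) ^ (2 * p))) :
    σ β = β := by
  have hβ0 : β ≠ 0 := by
    rintro rfl
    exact eigenProd_ne_zero D.δ D.k hc0 D.d (by rw [← hβ, zero_pow hp.ne_zero])
  have hcast : algebraMap K Ω ((p : K) ^ 2) = (p : Ω) ^ 2 := by rw [map_pow, map_natCast]
  refine apply_root_eq hp hc hc0 hβ hF (isSeparable_ζ hp hpΩ)
    (isSeparable_of_pow hpΩ hβ0 (hβ ▸ isSeparable_eigenProd _ _ hcsep _)) hσζ hσc V.valuation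
    (P := V.valuation (p : Ω)) (zero_lt_iff.2 ((map_ne_zero _).2 hpΩ))
    ((V.valuation_le_one_iff _).2 (natCast_mem V p)) rfl (fun x hx h ↦ ?_)
    fun i ↦ by rw [← map_pow]; exact hsmall i
  rw [← map_pow, ← hcast] at h ⊢
  refine V.valuation_apply_lt F hV hx (fun h0 ↦ hpΩ ?_) h
  rw [← map_natCast (algebraMap K Ω), pow_eq_zero_iff two_ne_zero |>.1 h0, map_zero]

lemma dvd_of_apply_eq [IsAlgClosed Ω] (hp : p.Prime) (hpΩ : (p : Ω) ≠ 0) {α : Ω} (hα0 : α ≠ 0)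
    (hα : D.Inv α) (hαsep : IsSeparable K α)
    (hF : ∀ y : Ω, IsSeparable K y → (∀ h ∈ F.fixingSubgroup, (h ^ p) y = y) → y ∈ F)
    {σ : Ω ≃ₐ[K] Ω} (hσζ : σ D.ζ = D.ζ) {j : ℕ} (hσα : σ α = D.ζ ^ j * α)
    {V₁ V₂ : ValuationSubring Ω} (hV₁ : ∀ x ∈ F, (σ x ∈ V₁ ↔ x ∈ V₁))
    (hV₂ : ∀ x ∈ F, (σ x ∈ V₂ ↔ x ∈ V₂))
    (happ : ∀ r₁ r₂ : Ω, r₁ ≠ 0 → r₂ ≠ 0 → ∃ t : K,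
      V₁.valuation (algebraMap K Ω t) < V₁.valuation r₁ ∧
      V₂.valuation (1 - algebraMap K Ω t) < V₂.valuation r₂) : p ∣ j := by
  have hT : σ (eigenProd D.δ D.k α D.d) = eigenProd D.δ D.k α D.d := by
    obtain ⟨a, ha⟩ : ∃ a, a = α ^ p := ⟨_, rfl⟩
    have ha0 : a ≠ 0 := ha ▸ pow_ne_zero _ hα0
    have hσa : σ a = a := by
      rw [ha, map_pow, hσα, mul_pow, ← pow_mul, mul_comm j, pow_mul, D.prim.pow_eq_one, one_pow,
        one_mul]
    have hainv : D.Inv a := ha ▸ hα.pow p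
    have hz : D.Inv ((1 - a) / a) := fun τ h1 h2 ↦ by
      rw [map_div₀, map_sub, map_one, hainv τ h1 h2]
    have hz' : D.Inv (a - 1) := fun τ h1 h2 ↦ by rw [map_sub, map_one, hainv τ h1 h2]
    obtain ⟨M₁, hM₁, hle₁⟩ := hz.exists_orbit_le V₁.valuation
    obtain ⟨M₂, hM₂, hle₂⟩ := hz'.exists_orbit_le V₂.valuation
    have hP : (p : Ω) ^ (2 * p) ≠ 0 := pow_ne_zero _ hpΩ
    obtain ⟨t, ht₁, ht₂⟩ := happ _ _ (div_ne_zero hP hM₁) (div_ne_zero hP hM₂)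
    obtain ⟨b, hb⟩ : ∃ b, b = a + algebraMap K Ω t * (1 - a) := ⟨_, rfl⟩
    have hδb (i : ℕ) : (D.δ ^ i) b - 1 = (1 - algebraMap K Ω t) * (D.δ ^ i) (a - 1) := by
      rw [hb]
      simp only [map_add, map_mul, map_sub, map_one, AlgEquiv.commutes]
      ring
    have hδba (i : ℕ) : (D.δ ^ i) (b / a) - 1 = algebraMap K Ω t * (D.δ ^ i) ((1 - a) / a) := by
      have : (D.δ ^ i) a ≠ 0 := (map_ne_zero _).2 ha0
      rw [hb]
      simp only [map_div₀, map_add, map_mul, map_sub, map_one, AlgEquiv.commutes]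
      field_simp
      ring
    have hs₂ (i : ℕ) : V₂.valuation ((D.δ ^ i) b - 1) < V₂.valuation ((p : Ω) ^ (2 * p)) := by
      rw [hδb, map_mul]
      rw [map_div₀, lt_div_iff₀ (zero_lt_iff.2 ((map_ne_zero _).2 hM₂))] at ht₂
      exact (mul_le_mul_right (hle₂ i) _).trans_lt ht₂
    have hs₁ (i : ℕ) : V₁.valuation ((D.δ ^ i) (b / a) - 1) <
        V₁.valuation ((p : Ω) ^ (2 * p)) := by
      rw [hδba, map_mul]
      rw [map_div₀, lt_div_iff₀ (zero_lt_iff.2 ((map_ne_zero _).2 hM₁))] at ht₁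
      exact (mul_le_mul_right (hle₁ i) _).trans_lt ht₁
    have hbinv : D.Inv b := fun τ h1 h2 ↦ by
      rw [hb]
      simp only [map_add, map_mul, map_sub, map_one, AlgEquiv.commutes, hainv τ h1 h2]
    have hbainv : D.Inv (b / a) := fun τ h1 h2 ↦ by
      rw [map_div₀, hainv τ h1 h2, hbinv τ h1 h2]
    have hσb : σ b = b := by
      rw [hb]
      simp only [map_add, map_mul, map_sub, map_one, AlgEquiv.commutes, hσa]
    have hb0 : b ≠ 0 := by
      rintro rfl
      have h := hs₂ 0
      rw [map_zero, zero_sub, Valuation.map_neg, map_one] at h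
      refine absurd h (not_lt.2 ((V₂.valuation_le_one_iff _).2 (pow_mem (natCast_mem V₂ p) _)))
    have hasep : a ∈ separableClosure K Ω := by
      rw [ha]
      exact pow_mem (mem_separableClosure_iff.2 hαsep) _
    have hbsep : b ∈ separableClosure K Ω := by
      rw [hb]
      exact add_mem hasep
        (mul_mem ((separableClosure K Ω).algebraMap_mem t) (sub_mem (one_mem _) hasep))
    obtain ⟨β, hβ⟩ := IsAlgClosed.exists_pow_nat_eq (eigenProd D.δ D.k b D.d) hp.pos
    have hσβ : σ β = β := apply_root_eq_of_invariant hp hpΩ hbinv hb0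
      (mem_separableClosure_iff.1 hbsep) hβ hF hσζ hσb V₂ hV₂ hs₂
    have hT0 := eigenProd_ne_zero D.δ D.k hα0 D.d
    have hβ0 : β ≠ 0 := by
      rintro rfl
      exact eigenProd_ne_zero D.δ D.k hb0 D.d (by rw [← hβ, zero_pow hp.ne_zero])
    have hγ : (β / eigenProd D.δ D.k α D.d) ^ p = eigenProd D.δ D.k (b / a) D.d := by
      rw [div_pow, hβ, ← eigenProd_pow, ← ha, div_eq_iff (eigenProd_ne_zero D.δ D.k ha0 D.d),
        ← eigenProd_mul, div_mul_cancel₀ _ ha0]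
    have hσγ := apply_root_eq_of_invariant hp hpΩ hbainv (div_ne_zero hb0 ha0)
      (mem_separableClosure_iff.1 (div_mem hbsep hasep)) hγ hF hσζ
      (by rw [map_div₀, hσa, hσb]) V₁ hV₁ hs₁
    rw [map_div₀, hσβ, div_eq_div_iff ((map_ne_zero _).2 hT0) hT0] at hσγ
    exact (mul_left_cancel₀ hβ0 hσγ).symm
  have hcomm (n : ℕ) : σ (eigenProd D.δ D.k α n) = eigenProd D.δ D.k (σ α) n := by
    induction n with
    | zero => exact map_one σ
    | succ n ih => rw [eigenProd_succ, eigenProd_succ, map_mul, map_pow,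
        (hα.eigenProd n).comm hσζ, ih]
  rw [hcomm, hσα, eigenProd_mul, eigenProd_pow,
    mul_eq_right₀ (eigenProd_ne_zero D.δ D.k hα0 D.d)] at hT
  obtain ⟨n, hn⟩ := Nat.exists_eq_add_of_lt D.d_pos
  rw [zero_add] at hn
  rw [hn, D.eigenProd_ζ, ← pow_mul] at hT
  have hdvd := D.prim.dvd_of_pow_eq_one _ hT
  rw [← hn, hp.dvd_mul, hp.dvd_mul] at hdvd
  refine hdvd.resolve_left (not_or.2 ⟨D.not_dvd, fun h ↦ hp.one_lt.ne' ?_⟩)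
  have h1 : p ∣ D.k ^ D.d := dvd_pow (hp.dvd_of_dvd_pow h) D.d_pos.ne'
  rw [D.pow_d] at h1
  exact Nat.dvd_one.1 ((Nat.dvd_add_left (dvd_mul_right _ _)).1 h1)

end KummerDatum

namespace KummerDatum

variable {K Ω : Type*} [Field K] [Field Ω] [Algebra K Ω] {F : IntermediateField K Ω} {p : ℕ}
  {D : KummerDatum F p} [Normal K F] [Normal K Ω]

/-- Lagrange resolvents. -/
lemma exists_apply_eq_pow_mul (hp : p.Prime) (hpΩ : (p : Ω) ≠ 0)
    (hFsep : ∀ y ∈ F, IsSeparable K y) {σ : Ω ≃ₐ[K] Ω} (hσζ : σ D.ζ = D.ζ) {x : Ω} (hx : x ∈ F)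
    (hσp : (σ ^ p) x = x) (hσ : σ x ≠ x) :
    ∃ (α : Ω) (j : ℕ), α ≠ 0 ∧ D.Inv α ∧ IsSeparable K α ∧ σ α = D.ζ ^ j * α ∧ ¬ p ∣ j := by
  have hmemF (i : ℕ) : (σ ^ i) x ∈ F := apply_mem_of_normal F _ hx
  let A (m : ℕ) : Ω := ∑ i ∈ Finset.range p, D.ζ ^ (m * i) * (σ ^ i) x
  have hA (m : ℕ) : D.ζ ^ m * σ (A m) = A m := by
    have h1 : D.ζ ^ m * σ (A m) = ∑ i ∈ Finset.range p, D.ζ ^ (m * (i + 1)) * (σ ^ (i + 1)) x := by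
      simp only [A, map_sum, map_mul, map_pow, hσζ, Finset.mul_sum]
      refine Finset.sum_congr rfl fun i _ ↦ ?_
      rw [pow_succ' σ, AlgEquiv.mul_apply]
      ring
    have h2 := Finset.sum_range_succ (fun i ↦ D.ζ ^ (m * i) * (σ ^ i) x) p
    rw [Finset.sum_range_succ' (fun i ↦ D.ζ ^ (m * i) * (σ ^ i) x) p] at h2
    simp only [mul_comm m p, pow_mul D.ζ p, D.prim.pow_eq_one, one_pow, hσp, mul_zero, pow_zero,
      AlgEquiv.one_apply] at h2
    rw [h1]
    exact add_right_cancel h2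
  obtain ⟨m, hm0, hmp, hAm⟩ : ∃ m, 0 < m ∧ m < p ∧ A m ≠ 0 := by
    by_contra! h
    have hsum : ∑ m ∈ Finset.range p, A m = p * x := by
      simp only [A]
      rw [Finset.sum_comm, Finset.sum_eq_single_of_mem 0 (Finset.mem_range.2 hp.pos)]
      · simp
      · intro i hi hi0
        simp only [mul_comm _ i, pow_mul]
        rw [← Finset.sum_mul, IsPrimitiveRoot.geom_sum_eq_zero (k := p) ?_ hp.one_lt, zero_mul]
        exact D.prim.pow_of_coprime i
          ((Nat.coprime_of_lt_prime hi0 (Finset.mem_range.1 hi) hp).symm)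
    rw [Finset.sum_eq_single_of_mem 0 (Finset.mem_range.2 hp.pos)
      fun m hm hm0 ↦ h m (Nat.pos_of_ne_zero hm0) (Finset.mem_range.1 hm)] at hsum
    have h0 := hA 0
    rw [pow_zero, one_mul, hsum, map_mul, map_natCast] at h0
    exact hσ (mul_left_cancel₀ hpΩ h0)
  refine ⟨A m, (p - 1) * m, hAm, fun τ hτ hτζ ↦ ?_, ?_, ?_, ?_⟩
  · rw [IntermediateField.mem_fixingSubgroup_iff] at hτ
    simp only [A, map_sum, map_mul, map_pow, hτζ]
    exact Finset.sum_congr rfl fun i _ ↦ by rw [hτ _ (hmemF i)]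
  · refine mem_separableClosure_iff.1 (sum_mem fun i _ ↦ mul_mem (pow_mem ?_ _) ?_)
    · exact mem_separableClosure_iff.2 (isSeparable_ζ hp hpΩ)
    · exact mem_separableClosure_iff.2 (hFsep _ (hmemF i))
  · refine mul_left_cancel₀ (pow_ne_zero m (D.prim.ne_zero hp.ne_zero)) ?_
    rw [hA, ← mul_assoc, ← pow_add]
    have : m + (p - 1) * m = p * m := by
      obtain ⟨r, rfl⟩ := Nat.exists_eq_add_of_lt hp.pos
      simp only [zero_add, add_tsub_cancel_right]
      ring
    rw [this, pow_mul, D.prim.pow_eq_one, one_pow, one_mul]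
  · rw [hp.dvd_mul]
    rintro (h | h)
    · exact absurd (Nat.le_of_dvd (Nat.sub_pos_of_lt hp.one_lt) h)
        (not_le.2 (Nat.sub_lt hp.pos one_pos))
    · exact absurd (Nat.le_of_dvd hm0 h) (not_le.2 hmp)

end KummerDatum

/-- The case where `p` is invertible in `K`: an automorphism of order `p` cannot act nontrivially
on `F`. -/
lemma apply_eq_of_pow_apply_eq_of_ne_zero {K Ω : Type*} [Field K] [Field Ω] [Algebra K Ω]
    [Normal K Ω] [IsAlgClosed Ω] {F : IntermediateField K Ω} [Normal K F] {p : ℕ} (hp : p.Prime)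
    (hpΩ : (p : Ω) ≠ 0) (hFsep : ∀ y ∈ F, IsSeparable K y)
    (hF : ∀ y : Ω, IsSeparable K y → (∀ h ∈ F.fixingSubgroup, (h ^ p) y = y) → y ∈ F)
    {V₁ V₂ : ValuationSubring Ω} (hV₁ : ∀ σ : Ω ≃ₐ[K] Ω, ∀ x ∈ F, (σ x ∈ V₁ ↔ x ∈ V₁))
    (hV₂ : ∀ σ : Ω ≃ₐ[K] Ω, ∀ x ∈ F, (σ x ∈ V₂ ↔ x ∈ V₂))
    (happ : ∀ r₁ r₂ : Ω, r₁ ≠ 0 → r₂ ≠ 0 → ∃ t : K,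
      V₁.valuation (algebraMap K Ω t) < V₁.valuation r₁ ∧
      V₂.valuation (1 - algebraMap K Ω t) < V₂.valuation r₂)
    {σ : Ω ≃ₐ[K] Ω} {x : Ω} (hx : x ∈ F) (hσ : (σ ^ p) x = x) : σ x = x := by
  have : Fact p.Prime := ⟨hp⟩
  obtain ⟨D⟩ := exists_kummerDatum F hp hpΩ
  have hσζ : (σ ^ (p - 1)) D.ζ = D.ζ := by
    have : NeZero p := ⟨hp.ne_zero⟩
    have h1 := congrArg Units.val
      (ZMod.units_pow_card_sub_one_eq_one p (D.prim.autToPow K (σ : Ω ≃ₐ[K] Ω)))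
    rw [← map_pow, Units.val_one] at h1
    rw [← D.prim.autToPow_spec K (σ ^ (p - 1)), h1, ZMod.val_one, pow_one]
  by_contra hne
  obtain ⟨α, j, hα0, hα, hαsep, hσα, hj⟩ := KummerDatum.exists_apply_eq_pow_mul hp hpΩ hFsep hσζ hx
    (by
      rw [← pow_mul, mul_comm, pow_mul]
      generalize p - 1 = n
      induction n with
      | zero => rfl
      | succ n ih => rw [pow_succ, AlgEquiv.mul_apply, hσ, ih])
    (fun h ↦ hne (by
      conv_rhs => rw [← hσ, ← Nat.sub_add_cancel hp.one_le, pow_succ', AlgEquiv.mul_apply, h]))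
  exact hj (KummerDatum.dvd_of_apply_eq hp hpΩ hα0 hα hαsep hF hσζ hσα (hV₁ _) (hV₂ _) happ)

/-- Approximate roots of `X ^ p - X` are close to integers. -/
lemma ValuationSubring.exists_valuation_sub_intCast_lt {Ω : Type*} [Field Ω]
    (V : ValuationSubring Ω) {p : ℕ} (hp : p.Prime) (hpΩ : (p : Ω) = 0) {β : Ω}
    (hβ : V.valuation (β ^ p - β) < 1) : ∃ n : ℤ, V.valuation (β - n) < 1 := by
  have hβV : β ∈ V := by
    rw [← V.valuation_le_one_iff]
    by_contra! h
    have h1 : V.valuation β < V.valuation (β ^ p) := by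
      rw [map_pow]
      exact lt_self_pow₀ h hp.one_lt
    rw [V.valuation.map_sub_eq_of_lt_left h1] at hβ
    exact lt_asymm hβ (h.trans h1)
  have : Fact p.Prime := ⟨hp⟩
  have : CharP (IsLocalRing.ResidueField V) p := by
    refine (CharP.charP_iff_prime_eq_zero hp).2 ?_
    have hpV : (p : V) = 0 := Subtype.ext (by simpa using hpΩ)
    rw [← map_natCast (IsLocalRing.residue V), hpV, map_zero]
  obtain ⟨n, hn⟩ := (mem_bot_iff_intCast p (IsLocalRing.ResidueField V)).1
    ((Subfield.mem_bot_iff_pow_eq_self _ p (x := IsLocalRing.residue V ⟨β, hβV⟩)).2 (by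
      rw [← map_pow, ← sub_eq_zero, ← map_sub, IsLocalRing.residue_eq_zero_iff,
        V.valuation_lt_one_iff]
      exact hβ))
  refine ⟨n, ?_⟩
  rw [eq_comm, ← map_intCast (IsLocalRing.residue V), ← sub_eq_zero, ← map_sub,
    IsLocalRing.residue_eq_zero_iff, V.valuation_lt_one_iff] at hn
  simpa using hn

lemma exists_intCast_eq_of_pow_eq {Ω : Type*} [Field Ω] {p : ℕ} (hp : p.Prime)
    (hpΩ : (p : Ω) = 0) {x : Ω} (hx : x ^ p = x) : ∃ n : ℤ, (n : Ω) = x := by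
  have : Fact p.Prime := ⟨hp⟩
  have : CharP Ω p := (CharP.charP_iff_prime_eq_zero hp).2 hpΩ
  exact (mem_bot_iff_intCast p Ω).1 ((Subfield.mem_bot_iff_pow_eq_self Ω p).2 hx)

section ArtinSchreier

variable {K Ω : Type*} [Field K] [Field Ω] [Algebra K Ω] {F : IntermediateField K Ω} {p : ℕ}

lemma apply_artinSchreier_root_eq (hp : p.Prime) (hpΩ : (p : Ω) = 0)
    (hF : ∀ y : Ω, IsSeparable K y → (∀ h ∈ F.fixingSubgroup, (h ^ p) y = y) → y ∈ F)
    {b β : Ω} (hb : b ∈ F) (hbsep : IsSeparable K b) (hβ : β ^ p - β = b) {σ : Ω ≃ₐ[K] Ω}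
    (hσb : σ b = b) (V : ValuationSubring Ω) (hV : ∀ x ∈ F, (σ x ∈ V ↔ x ∈ V))
    (hbV : V.valuation b < 1) : σ β = β := by
  have : Fact p.Prime := ⟨hp⟩
  have : CharP Ω p := (CharP.charP_iff_prime_eq_zero hp).2 hpΩ
  have hdiff (τ : Ω ≃ₐ[K] Ω) (hτ : τ b = b) : (τ β - β) ^ p = τ β - β := by
    rw [sub_pow_char, ← sub_eq_zero]
    have h : τ β ^ p - τ β = b := by rw [← map_pow, ← map_sub, hβ, hτ]
    linear_combination h - hβ
  have hβF : β ∈ F := by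
    refine hF β (isSeparable_of_pow_sub hpΩ (hβ ▸ hbsep)) fun h hh ↦ ?_
    obtain ⟨n, hn⟩ := exists_intCast_eq_of_pow_eq hp hpΩ
      (hdiff h ((F.mem_fixingSubgroup_iff h).1 hh b hb))
    have hm (m : ℕ) : (h ^ m) β = β + m * n := by
      induction m with
      | zero => simp
      | succ m ih =>
        rw [pow_succ', AlgEquiv.mul_apply, ih, map_add, map_mul, map_natCast, map_intCast]
        push_cast
        linear_combination -hn
    rw [hm, hpΩ, zero_mul, add_zero]
  obtain ⟨n, hn⟩ := V.exists_valuation_sub_intCast_lt hp hpΩ (β := β) (hβ ▸ hbV)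
  have hn' : V.valuation (σ (β - n)) < 1 := by
    have h1 := V.valuation_apply_lt F hV (x := β - n) (sub_mem hβF (intCast_mem F n))
      (one_ne_zero (α := K))
    rw [map_one, map_one] at h1
    exact h1 hn
  have he : V.valuation (σ β - β) < 1 := by
    have := V.valuation.map_sub_lt hn' hn
    rwa [map_sub σ, map_intCast, sub_sub_sub_cancel_right] at this
  by_contra hne
  have h1 : (σ β - β) ^ (p - 1) = 1 := by
    refine mul_right_cancel₀ (sub_ne_zero.2 hne) ?_
    rw [← pow_succ, Nat.sub_add_cancel hp.one_le, hdiff σ hσb, one_mul]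
  have h2 := V.valuation.map_rootOfUnity (Nat.sub_pos_of_lt hp.one_lt).ne' h1
  exact he.ne h2

lemma exists_apply_eq_add_one [Normal K F] [Normal K Ω] (hp : p.Prime) (hpΩ : (p : Ω) = 0)
    {σ : Ω ≃ₐ[K] Ω} {x : Ω} (hx : x ∈ F) (hσp : (σ ^ p) x = x) (hσ : σ x ≠ x) :
    ∃ α ∈ F, σ α = α + 1 := by
  have : Fact p.Prime := ⟨hp⟩
  have : CharP Ω p := (CharP.charP_iff_prime_eq_zero hp).2 hpΩ
  let S : Module.End K Ω := σ.toLinearMap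
  have hS (y : Ω) : S y = σ y := rfl
  have hSpow (n : ℕ) (y : Ω) : (S ^ n) y = (σ ^ n) y := by
    induction n with
    | zero => rfl
    | succ n ih => rw [pow_succ', pow_succ', Module.End.mul_apply, ih]; rfl
  let N : ℕ → Ω := fun n ↦ ((S - 1) ^ n) x
  have hN (n : ℕ) : N (n + 1) = σ (N n) - N n := by
    simp only [N, pow_succ', Module.End.mul_apply, LinearMap.sub_apply, Module.End.one_apply, hS]
  have hNF (n : ℕ) : N n ∈ F := by
    induction n with
    | zero => exact hx
    | succ n ih => rw [hN]; exact sub_mem (apply_mem_of_normal F σ ih) ih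
  have hNp : N p = 0 := by
    have : CharP K p := (CharP.charP_iff_prime_eq_zero hp).2
      ((algebraMap K Ω).injective (by rw [map_natCast, hpΩ, map_zero]))
    have : CharP (Module.End K Ω) p := charP_of_injective_algebraMap' K p
    simp only [N]
    rw [sub_pow_char_of_commute p (Commute.one_right S), one_pow, LinearMap.sub_apply, hSpow, hσp]
    simp
  obtain ⟨n, hn, hmin⟩ : ∃ n, N n = 0 ∧ ∀ m < n, N m ≠ 0 := by
    classical
    have hex : ∃ n, N n = 0 := ⟨p, hNp⟩
    exact ⟨Nat.find hex, Nat.find_spec hex, fun m hm ↦ Nat.find_min hex hm⟩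
  have h0 : N 0 = x := rfl
  have h1 : N 1 = σ x - x := by rw [hN, h0]
  match n, hn, hmin with
  | 0, hn, _ =>
    exact absurd (by rw [← h0, hn, map_zero]) hσ
  | 1, hn, _ => exact absurd (sub_eq_zero.1 (h1 ▸ hn)) hσ
  | n + 2, hn, hmin =>
    have hc := hmin (n + 1) (Nat.lt_succ_self _)
    rw [hN, sub_eq_zero] at hn
    refine ⟨N n / N (n + 1), div_mem (hNF _) (hNF _), ?_⟩
    rw [map_div₀, hn, div_add_one hc]
    congr 1
    rw [hN]
    ring

/-- The case of characteristic `p`: an automorphism of order `p` cannot act nontrivially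
on `F`. -/
lemma apply_eq_of_pow_apply_eq_of_eq_zero [Normal K Ω] [IsAlgClosed Ω] [Normal K F] (hp : p.Prime)
    (hpΩ : (p : Ω) = 0) (hFsep : ∀ y ∈ F, IsSeparable K y)
    (hF : ∀ y : Ω, IsSeparable K y → (∀ h ∈ F.fixingSubgroup, (h ^ p) y = y) → y ∈ F)
    {V₁ V₂ : ValuationSubring Ω} (hV₁ : ∀ σ : Ω ≃ₐ[K] Ω, ∀ x ∈ F, (σ x ∈ V₁ ↔ x ∈ V₁))
    (hV₂ : ∀ σ : Ω ≃ₐ[K] Ω, ∀ x ∈ F, (σ x ∈ V₂ ↔ x ∈ V₂))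
    (happ : ∀ r₁ r₂ : Ω, r₁ ≠ 0 → r₂ ≠ 0 → ∃ t : K,
      V₁.valuation (algebraMap K Ω t) < V₁.valuation r₁ ∧
      V₂.valuation (1 - algebraMap K Ω t) < V₂.valuation r₂)
    {σ : Ω ≃ₐ[K] Ω} {x : Ω} (hx : x ∈ F) (hσ : (σ ^ p) x = x) : σ x = x := by
  have : Fact p.Prime := ⟨hp⟩
  have : CharP Ω p := (CharP.charP_iff_prime_eq_zero hp).2 hpΩ
  by_contra hne
  obtain ⟨α, hα, hσα⟩ := exists_apply_eq_add_one hp hpΩ hx hσ hne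
  have hroot (b : Ω) : ∃ β : Ω, β ^ p - β = b := by
    obtain ⟨β, hβ⟩ := IsAlgClosed.exists_root (.X ^ p - .X - .C b : Polynomial Ω) (by
      have h1 : (.X ^ p - .X : Polynomial Ω).degree = p := by
        rw [Polynomial.degree_sub_eq_left_of_degree_lt] <;> simp [hp.one_lt]
      rw [Polynomial.degree_sub_eq_left_of_degree_lt, h1]
      · simpa using hp.ne_zero
      · rw [h1]
        exact Polynomial.degree_C_le.trans_lt (by simpa using hp.pos))
    exact ⟨β, by simpa [sub_eq_zero] using hβ⟩
  obtain ⟨a, ha⟩ : ∃ a, a = α ^ p - α := ⟨_, rfl⟩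
  have haF : a ∈ F := ha ▸ sub_mem (pow_mem hα _) hα
  have hσa : σ a = a := by
    rw [ha, map_sub, map_pow, hσα, add_pow_char, one_pow]
    ring
  obtain ⟨t, ht₁, ht₂⟩ : ∃ t : K, V₁.valuation (algebraMap K Ω t * a) < 1 ∧
      V₂.valuation ((1 - algebraMap K Ω t) * a) < 1 := by
    by_cases ha0 : a = 0
    · exact ⟨0, by simp [ha0], by simp [ha0]⟩
    · obtain ⟨t, h1, h2⟩ := happ a⁻¹ a⁻¹ (inv_ne_zero ha0) (inv_ne_zero ha0)
      refine ⟨t, ?_, ?_⟩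
      · rwa [map_mul, ← lt_div_iff₀ (zero_lt_iff.2 ((map_ne_zero _).2 ha0)), one_div, ← map_inv₀]
      · rwa [map_mul, ← lt_div_iff₀ (zero_lt_iff.2 ((map_ne_zero _).2 ha0)), one_div, ← map_inv₀]
  obtain ⟨β₁, hβ₁⟩ := hroot (algebraMap K Ω t * a)
  obtain ⟨β₂, hβ₂⟩ := hroot ((1 - algebraMap K Ω t) * a)
  have hb₁ : algebraMap K Ω t * a ∈ F := mul_mem (F.algebraMap_mem t) haF
  have hb₂ : (1 - algebraMap K Ω t) * a ∈ F :=
    mul_mem (sub_mem (one_mem _) (F.algebraMap_mem t)) haF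
  have h1 := apply_artinSchreier_root_eq hp hpΩ hF hb₁ (hFsep _ hb₁) hβ₁ (σ := σ)
    (by rw [map_mul, AlgEquiv.commutes, hσa]) V₁ (hV₁ σ) ht₁
  have h2 := apply_artinSchreier_root_eq hp hpΩ hF hb₂ (hFsep _ hb₂) hβ₂ (σ := σ)
    (by rw [map_mul, map_sub, map_one, AlgEquiv.commutes, hσa]) V₂ (hV₂ σ) ht₂
  obtain ⟨n, hn⟩ := exists_intCast_eq_of_pow_eq hp hpΩ (x := β₁ + β₂ - α) (by
    rw [sub_pow_char, add_pow_char]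
    linear_combination hβ₁ + hβ₂ + ha)
  have h3 := congrArg σ hn
  rw [map_intCast, map_sub, map_add, h1, h2, hσα, hn] at h3
  exact one_ne_zero (α := Ω) (by linear_combination h3)

end ArtinSchreier

/-- Let `p ≠ q` be primes. If `K` admits two nontrivial independent
`(p,q)`-henselian valuations, then `K = K(p,q)`: every finite Galois extension of `K` of
degree `p^n q^m` is trivial. -/
theorem statement_11 (p q : ℕ) (hp : p.Prime) (hq : q.Prime) (hpq : p ≠ q)
    (K : Type) [Field K] (O₁ O₂ : ValuationSubring K)
    (h1 : IsPQHenselian p q O₁) (h2 : IsPQHenselian p q O₂)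
    (hnt1 : O₁ ≠ ⊤) (hnt2 : O₂ ≠ ⊤)
    (hindep : O₁.toSubring ⊔ O₂.toSubring = (⊤ : Subring K)) :
    ∀ L : IntermediateField K (AlgebraicClosure K),
      FiniteDimensional K ↥L → IsGalois K ↥L →
      (∃ n m : ℕ, Module.finrank K ↥L = p ^ n * q ^ m) → L = ⊥ := by
  intro L hfin hgal hdeg
  set Ω := AlgebraicClosure K
  obtain ⟨V₁, hV₁, hinv₁⟩ := h1.exists_extension
  obtain ⟨V₂, hV₂, hinv₂⟩ := h2.exists_extension
  have happ := ValuationSubring.exists_valuation_lt_of_independent hnt1 hnt2 hindep hV₁ hV₂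
  have hLF : L ≤ maxPQExt p q K Ω := le_maxPQExt hdeg
  have hFsep : ∀ y ∈ maxPQExt p q K Ω, IsSeparable K y := fun y ↦
    isSeparable_of_mem_maxPQExt hp hq
  by_contra hL
  have hdvd : ∃ l, (l = p ∨ l = q) ∧ l ∣ Module.finrank K L := by
    obtain ⟨n, m, hnm⟩ := hdeg
    rw [hnm]
    rcases n with _ | n
    · rcases m with _ | m
      · exact absurd (IntermediateField.finrank_eq_one_iff.1 (by simpa using hnm)) hL
      · exact ⟨q, .inr rfl, (dvd_pow_self q m.succ_ne_zero).mul_left _⟩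
    · exact ⟨p, .inl rfl, (dvd_pow_self p n.succ_ne_zero).mul_right _⟩
  obtain ⟨l, hl, hdvd⟩ := hdvd
  have hlp : l.Prime := by rcases hl with rfl | rfl <;> assumption
  have : Fact l.Prime := ⟨hlp⟩
  have hF (y : Ω) (hy : IsSeparable K y) := mem_maxPQExt_of_forall_pow hp hq hl hy
  rw [← IsGalois.card_aut_eq_finrank] at hdvd
  obtain ⟨τ, hτ⟩ := exists_prime_orderOf_dvd_card' l hdvd
  obtain ⟨σ, rfl⟩ := AlgEquiv.restrictNormalHom_surjective (F := K) (K₁ := L) Ω τ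
  have hσ (x : L) : (σ ^ l) x = x := by
    rw [← AlgEquiv.restrictNormalHom_apply, map_pow, ← hτ, pow_orderOf_eq_one, AlgEquiv.one_apply]
  have hfix (x : L) : σ x = x := by
    by_cases hlΩ : (l : Ω) = 0
    · exact apply_eq_of_pow_apply_eq_of_eq_zero hlp hlΩ hFsep hF hinv₁ hinv₂ happ (hLF x.2) (hσ x)
    · exact apply_eq_of_pow_apply_eq_of_ne_zero hlp hlΩ hFsep hF hinv₁ hinv₂ happ (hLF x.2) (hσ x)
  have h1 : AlgEquiv.restrictNormalHom L σ = 1 := by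
    ext x
    rw [AlgEquiv.restrictNormalHom_apply, hfix, AlgEquiv.one_apply]
  rw [h1, orderOf_one] at hτ
  exact hlp.one_lt.ne hτ
end
end

section
/- Let K be a field and let O₁ ⊆ O₂ be valuation rings of K with maximal ideals M₁ ⊇ M₂ (so O₂ is a coarsening of O₁). The image of O₁ under the residue map O₂ → O₂/M₂ is a valuation ring O₁/M₂ of the residue field Kv₂ = O₂/M₂. Then O₁ is solv-henselian if and only if O₂ is solv-henselian and O₁/M₂ is a solv-henselian valuation ring of Kv₂. -/
noncomputable section

/-- The maximal solvable extension of `K` inside an ambient field extension `Ω`: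
the compositum of all finite Galois subextensions of `Ω/K` with solvable Galois group. -/
def maxSolvableExt (K Ω : Type*) [Field K] [Field Ω] [Algebra K Ω] :
    IntermediateField K Ω :=
  ⨆ L : {L : IntermediateField K Ω //
      FiniteDimensional K ↥L ∧ IsGalois K ↥L ∧ IsSolvable (↥L ≃ₐ[K] ↥L)}, L.1

/-- `K^solv`, the maximal solvable extension of `K` (inside a fixed algebraic closure). -/
abbrev solvClosure (K : Type*) [Field K] : IntermediateField K (AlgebraicClosure K) :=
  maxSolvableExt K (AlgebraicClosure K)

/-- A valuation (subring) of `K` is solv-henselian if it extends uniquely to `K^solv`. -/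
def IsSolvHenselian {K : Type*} [Field K] (O : ValuationSubring K) : Prop :=
  ∃! O' : ValuationSubring ↥(solvClosure K),
    O'.comap (algebraMap K ↥(solvClosure K)) = O

universe u

section IntegralDichotomy

open IsLocalRing in
theorem isIntegral_of_map_maximalIdeal_sup_span_inv_eq_top {R L : Type*} [CommRing R]
    [IsLocalRing R] [Field L] [Algebra R L] {x : L} (hx0 : x ≠ 0)
    (h : (maximalIdeal R).map (algebraMap R (Algebra.adjoin R {x⁻¹})) ⊔
      Ideal.span {⟨x⁻¹, Algebra.subset_adjoin rfl⟩} = ⊤) : IsIntegral R x := by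
  let := invertibleOfNonzero (inv_ne_zero hx0)
  obtain ⟨p, hp, hpx⟩ := Algebra.exists_aeval_invOf_eq_zero_of_idealMap_adjoin_sup_span_eq_top _ _
    (maximalIdeal.isMaximal R).ne_top h
  have H : IsUnit p.leadingCoeff := of_not_not fun h ↦ by
    have := sub_mem ((mem_maximalIdeal _).mpr h) hp
    simp at this
  rw [invOf_eq_inv, inv_inv] at hpx
  obtain ⟨c, hc⟩ := H.exists_left_inv
  have hpx' : Polynomial.aeval x (Polynomial.C c * p) = 0 := by rw [map_mul, hpx, mul_zero]
  exact ⟨_, Polynomial.monic_C_mul_of_mul_leadingCoeff_eq_one hc, hpx'⟩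

theorem Subalgebra.exists_valuationSubring_of_ne_top {R L : Type*} [Field L] [CommRing R]
    [Algebra R L] (B : Subalgebra R L) (I : Ideal B) (hI : I ≠ ⊤) :
    ∃ V : ValuationSubring L, (∀ b : B, (b : L) ∈ V) ∧ ∀ b ∈ I, (b : L) ∈ V.nonunits := by
  obtain ⟨V, hV, hI⟩ := Ideal.image_subset_nonunits_valuationSubring (A := B.toSubring) I hI
  exact ⟨V, fun b ↦ hV b.2, fun b hb ↦ hI ⟨b, hb, rfl⟩⟩

open IsLocalRing in
/-- An element of a field that is not integral over a local ring `R` is avoided by some valuation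
ring dominating `R`. -/
theorem exists_valuationSubring_notMem_of_not_isIntegral {R L : Type*} [CommRing R] [IsLocalRing R]
    [Field L] [Algebra R L] {x : L} (hx : ¬ IsIntegral R x) :
    ∃ V : ValuationSubring L, (∀ r, algebraMap R L r ∈ V) ∧
      (∀ r ∈ maximalIdeal R, algebraMap R L r ∈ V.nonunits) ∧ x ∉ V := by
  have hx0 : x ≠ 0 := by rintro rfl; exact hx isIntegral_zero
  have hB : (maximalIdeal R).map (algebraMap R (Algebra.adjoin R {x⁻¹})) ⊔
      Ideal.span {⟨x⁻¹, Algebra.subset_adjoin rfl⟩} ≠ ⊤ := fun eq ↦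
    hx (isIntegral_of_map_maximalIdeal_sup_span_inv_eq_top hx0 eq)
  obtain ⟨V, hV, hI⟩ := Subalgebra.exists_valuationSubring_of_ne_top _ _ hB
  refine ⟨V, fun r ↦ hV (algebraMap R _ r), fun r hr ↦
    hI (algebraMap R _ r) (Ideal.mem_sup_left (Ideal.mem_map_of_mem _ hr)), ?_⟩
  have hmem : x⁻¹ ∈ V.nonunits :=
    hI ⟨x⁻¹, Algebra.subset_adjoin rfl⟩ (Ideal.mem_sup_right (Ideal.subset_span rfl))
  exact (V.inv_mem_nonunits_iff.mp hmem).resolve_left hx0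

variable {K L : Type*} [Field K] [Field L] [Algebra K L] (O : ValuationSubring K)

open IsLocalRing in
/-- A valuation ring `O` extends to a valuation ring avoiding any given element that is not integral
over `O`. -/
theorem ValuationSubring.exists_comap_eq_notMem_of_not_isIntegral {x : L}
    (hx : ¬ IsIntegral O x) :
    ∃ V : ValuationSubring L, V.comap (algebraMap K L) = O ∧ x ∉ V := by
  obtain ⟨V, hV, hI, hxV⟩ := exists_valuationSubring_notMem_of_not_isIntegral hx
  refine ⟨V, le_antisymm (fun r hr ↦ ?_) fun r hr ↦ hV ⟨r, hr⟩, hxV⟩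
  by_contra hrO
  have hr0 : r ≠ 0 := by rintro rfl; exact hrO O.zero_mem
  have hr1 : r⁻¹ ∈ O.nonunits := O.inv_mem_nonunits_iff.mpr (.inr hrO)
  rw [← SetLike.mem_coe, ← O.image_maximalIdeal] at hr1
  obtain ⟨s, hs, hsr⟩ := hr1
  have hmem : algebraMap O L s ∈ V.nonunits := hI s hs
  have : algebraMap O L s = (algebraMap K L r)⁻¹ := by
    rw [IsScalarTower.algebraMap_apply O K L, ← map_inv₀]; exact congrArg _ hsr
  rw [this, V.inv_mem_nonunits_iff] at hmem
  rcases hmem with h | h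
  · exact hr0 (by simpa using h)
  · exact h hr

variable {O} in
theorem ValuationSubring.mem_of_isIntegral_of_comap_eq {V : ValuationSubring L}
    (hV : O ≤ V.comap (algebraMap K L)) {x : L} (hx : IsIntegral O x) : x ∈ V := by
  obtain ⟨p, hp, hpx⟩ := hx
  have hx' : IsIntegral V x := by
    refine ⟨p.map (((algebraMap K L).comp O.subtype).codRestrict V.toSubring
      fun r ↦ hV r.2), hp.map _, ?_⟩
    rw [Polynomial.eval₂_map]
    exact hpx
  obtain ⟨y, rfl⟩ := IsIntegrallyClosed.isIntegral_iff.mp hx'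
  exact y.2

variable {O} in
theorem ValuationSubring.isIntegral_algebraMap_iff {r : K} :
    IsIntegral O (algebraMap K L r) ↔ r ∈ O := by
  rw [_root_.isIntegral_algebraMap_iff (algebraMap K L).injective]
  constructor
  · intro h
    obtain ⟨y, rfl⟩ := IsIntegrallyClosed.isIntegral_iff.mp h
    exact y.2
  · intro h
    exact isIntegral_algebraMap (x := (⟨r, h⟩ : O))

variable {O} in
theorem isLocalRing_integralClosure_of_dichotomy
    (h : ∀ x : L, IsIntegral O x ∨ IsIntegral O x⁻¹) : IsLocalRing (integralClosure O L) :=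
  let V : ValuationSubring L := ⟨(integralClosure O L).toSubring, h⟩
  inferInstanceAs (IsLocalRing V)

open IsLocalRing in
/-- A valuation ring `O` of `K` extends uniquely to `L` iff every element of `L` or its inverse
is integral over `O`. -/
theorem ValuationSubring.existsUnique_comap_eq_iff :
    (∃! V : ValuationSubring L, V.comap (algebraMap K L) = O) ↔
      ∀ x : L, IsIntegral O x ∨ IsIntegral O x⁻¹ := by
  constructor
  · rintro ⟨V, -, hV⟩ x
    by_contra! h
    obtain ⟨V₁, h₁, hx₁⟩ := O.exists_comap_eq_notMem_of_not_isIntegral h.1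
    obtain ⟨V₂, h₂, hx₂⟩ := O.exists_comap_eq_notMem_of_not_isIntegral h.2
    obtain rfl : V₁ = V₂ := (hV _ h₁).trans (hV _ h₂).symm
    exact (V₁.mem_or_inv_mem x).elim hx₁ hx₂
  · intro h
    let A : ValuationSubring L := ⟨(integralClosure O L).toSubring, h⟩
    refine ⟨A, SetLike.ext fun r ↦ ValuationSubring.isIntegral_algebraMap_iff, fun V hV ↦ ?_⟩
    refine le_antisymm (fun x hx ↦ ?_) fun x hx ↦ mem_of_isIntegral_of_comap_eq hV.ge hx
    by_contra hxA
    have hy : x⁻¹ ∈ A := (A.mem_or_inv_mem x).resolve_left hxA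
    have : IsLocalRing (integralClosure O L) := isLocalRing_integralClosure_of_dichotomy h
    let ι : integralClosure O L →+* V :=
      (integralClosure O L).toSubring.subtype.codRestrict V.toSubring
        fun r ↦ mem_of_isIntegral_of_comap_eq hV.ge r.2
    have hmax : (maximalIdeal V).comap ι = maximalIdeal (integralClosure O L) := by
      have : ((maximalIdeal V).comap ι).IsMaximal := by
        have hp : ((maximalIdeal V).comap ι).IsPrime := inferInstance
        refine Ideal.isMaximal_of_isIntegral_of_isMaximal_comap (R := O) _ ?_
        convert maximalIdeal.isMaximal O
        ext r
        rw [Ideal.mem_comap, Ideal.mem_comap, mem_maximalIdeal, mem_maximalIdeal,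
          _root_.mem_nonunits_iff, _root_.mem_nonunits_iff, not_iff_not]
        constructor
        · intro hu
          obtain ⟨z, hz⟩ := hu.exists_right_inv
          have hz : algebraMap K L r * (z : L) = 1 := congrArg Subtype.val hz
          have hr0 : algebraMap K L r ≠ 0 := left_ne_zero_of_mul_eq_one hz
          have hrV : algebraMap K L (r : K)⁻¹ ∈ V := by
            rw [map_inv₀, ← eq_inv_of_mul_eq_one_right hz]; exact z.2
          have hrO : (r : K)⁻¹ ∈ O := hV.le hrV
          exact .of_mul_eq_one ⟨_, hrO⟩ (Subtype.ext (mul_inv_cancel₀ fun h0 ↦ hr0 (by simp [h0])))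
        · intro hu
          exact (hu.map (algebraMap O (integralClosure O L))).map ι
      exact eq_maximalIdeal this
    have hx0 : x ≠ 0 := by rintro rfl; exact hxA A.zero_mem
    have hmem : (⟨x⁻¹, hy⟩ : integralClosure O L) ∈ maximalIdeal (integralClosure O L) := by
      rw [mem_maximalIdeal, _root_.mem_nonunits_iff]
      intro hu
      obtain ⟨z, hz⟩ := hu.exists_right_inv
      apply hxA
      have : x⁻¹ * (z : L) = 1 := congrArg Subtype.val hz
      have : x = z := by field_simp at this; exact this.symm
      rw [this]; exact z.2
    rw [← hmax, Ideal.mem_comap, mem_maximalIdeal, _root_.mem_nonunits_iff] at hmem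
    apply hmem
    refine IsUnit.of_mul_eq_one ⟨x, hx⟩ (Subtype.ext (inv_mul_cancel₀ hx0))

variable {O} in
theorem exists_isIntegralClosure_of_dichotomy {L : Type u} [Field L] [Algebra K L]
    (h : ∀ x : L, IsIntegral O x ∨ IsIntegral O x⁻¹) :
    ∃ (B : Type u) (_ : CommRing B) (_ : Algebra O B) (_ : Algebra B L),
      IsScalarTower O B L ∧ IsIntegralClosure B O L ∧ IsFractionRing B L ∧
        IsIntegrallyClosed B ∧ IsLocalRing B ∧ IsLocalHom (algebraMap O B) :=
  let V : ValuationSubring L := ⟨(integralClosure O L).toSubring, h⟩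
  ⟨integralClosure O L, inferInstance, inferInstance, inferInstance, inferInstance, inferInstance,
    inferInstanceAs (IsFractionRing V L), inferInstanceAs (IsIntegrallyClosed V),
    inferInstanceAs (IsLocalRing V), Algebra.IsIntegral.isLocalHom _ _⟩

theorem dichotomy_algHom_iff {N : Type*} [Field N] [Algebra K N] (ι : L →ₐ[K] N) {x : L} :
    (IsIntegral O (ι x) ∨ IsIntegral O (ι x)⁻¹) ↔ (IsIntegral O x ∨ IsIntegral O x⁻¹) := by
  have key (y : L) : IsIntegral O (ι y) ↔ IsIntegral O y :=
    isIntegral_algHom_iff (ι.restrictScalars O) ι.injective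
  rw [← map_inv₀, key, key]

end IntegralDichotomy

section MaxSolvableExt

open Polynomial IntermediateField

theorem Polynomial.IsSplittingField.isSolvable_gal_iff {F : Type*} (E : Type*) [Field F] [Field E]
    [Algebra F E] (p : F[X]) [p.IsSplittingField F E] :
    Group.IsSolvable Gal(E/F) ↔ Group.IsSolvable p.Gal := by
  let ϕ : Gal(E/F) ≃* p.Gal := (IsSplittingField.algEquiv E p).autCongr
  exact ⟨fun _ ↦ Group.isSolvable_of_surjective (f := ϕ.toMonoidHom) ϕ.surjective,
    fun _ ↦ Group.isSolvable_of_isSolvable_injective (f := ϕ.toMonoidHom) ϕ.injective⟩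

variable {K Ω : Type*} [Field K] [Field Ω] [Algebra K Ω]

theorem le_maxSolvableExt (L : IntermediateField K Ω) [FiniteDimensional K L] [IsGalois K L]
    (hL : Group.IsSolvable Gal(L/K)) : L ≤ maxSolvableExt K Ω :=
  le_iSup (fun L : {L : IntermediateField K Ω //
      FiniteDimensional K L ∧ IsGalois K L ∧ IsSolvable Gal(L/K)} ↦ L.1) ⟨L, ‹_›, ‹_›, hL⟩

theorem exists_isSolvable_of_mem_maxSolvableExt {x : Ω} (hx : x ∈ maxSolvableExt K Ω) :
    ∃ L : IntermediateField K Ω, FiniteDimensional K L ∧ IsGalois K L ∧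
      Group.IsSolvable Gal(L/K) ∧ x ∈ L := by
  obtain ⟨s, hs⟩ := exists_finset_of_mem_iSup hx
  have h (L : {L : IntermediateField K Ω //
      FiniteDimensional K L ∧ IsGalois K L ∧ IsSolvable Gal(L/K)}) :
      ∃ p : K[X], p.Separable ∧ p.IsSplittingField K L.1 ∧ Group.IsSolvable p.Gal := by
    obtain ⟨L, h₁, h₂, h₃⟩ := L
    obtain ⟨p, hp, hpL⟩ := IsGalois.is_separable_splitting_field K L
    exact ⟨p, hp, hpL, (IsSplittingField.isSolvable_gal_iff L p).mp h₃⟩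
  choose p hp hpL hps using h
  have (L : {L : IntermediateField K Ω //
      FiniteDimensional K L ∧ IsGalois K L ∧ IsSolvable Gal(L/K)}) :
      FiniteDimensional K L.1 := L.2.1
  have (L : {L : IntermediateField K Ω //
      FiniteDimensional K L ∧ IsGalois K L ∧ IsSolvable Gal(L/K)}) : IsGalois K L.1 := L.2.2.1
  have hspl := isSplittingField_iSup (L := Ω) (Finset.prod_ne_zero_iff.mpr fun i (_ : i ∈ s) ↦
    (hp i).ne_zero) (fun i _ ↦ hpL i)
  have hnormal := Normal.of_isSplittingField (F := K)
    (E := (⨆ i ∈ s, i.1 : IntermediateField K Ω)) (∏ i ∈ s, p i)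
  have hsep : Algebra.IsSeparable K (⨆ i ∈ s, i.1 : IntermediateField K Ω) :=
    iSup_subtype'' (s : Set {L : IntermediateField K Ω // FiniteDimensional K L ∧ IsGalois K L ∧
      IsSolvable Gal(L/K)}) (fun i ↦ i.1) ▸ isSeparable_iSup K Ω
  refine ⟨⨆ i ∈ s, i.1, inferInstance, ⟨⟩, ?_, hs⟩
  refine (IsSplittingField.isSolvable_gal_iff _ (∏ i ∈ s, p i)).mpr ?_
  refine gal_prod_isSolvable (s := s.val.map p) fun q hq ↦ ?_
  obtain ⟨i, -, rfl⟩ := Multiset.mem_map.mp hq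
  exact hps i

theorem mem_maxSolvableExt_iff [Normal K Ω] {x : Ω} :
    x ∈ maxSolvableExt K Ω ↔ IsSeparable K x ∧ Group.IsSolvable (minpoly K x).Gal := by
  constructor
  · intro hx
    obtain ⟨L, _, _, _, hxL⟩ := exists_isSolvable_of_mem_maxSolvableExt hx
    have h : minpoly K x = minpoly K (⟨x, hxL⟩ : L) := (minpoly_eq (⟨x, hxL⟩ : L)).symm
    have : Fact (((minpoly K x).map (algebraMap K L)).Splits) :=
      ⟨h ▸ Normal.splits inferInstance _⟩
    refine ⟨?_, Group.isSolvable_of_surjective (Gal.restrict_surjective (minpoly K x) L)⟩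
    rw [IsSeparable, h]
    exact Algebra.IsSeparable.isSeparable K _
  · rintro ⟨hsep, hsol⟩
    have := adjoin_rootSet_isSplittingField (Normal.splits (F := K) inferInstance x)
    have := IsGalois.of_separable_splitting_field (F := K)
      (E := adjoin K ((minpoly K x).rootSet Ω)) hsep
    have := IsSplittingField.finiteDimensional (adjoin K ((minpoly K x).rootSet Ω)) (minpoly K x)
    refine le_maxSolvableExt (adjoin K ((minpoly K x).rootSet Ω))
      ((IsSplittingField.isSolvable_gal_iff _ (minpoly K x)).mpr hsol) (subset_adjoin _ _ ?_)
    exact mem_rootSet.mpr ⟨minpoly.ne_zero (Normal.isIntegral inferInstance x), minpoly.aeval K x⟩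

instance [Normal K Ω] : Algebra.IsSeparable K (maxSolvableExt K Ω) :=
  ⟨fun x ↦ by
    rw [IsSeparable, minpoly_eq]
    exact (mem_maxSolvableExt_iff.mp x.2).1⟩

end MaxSolvableExt

section ArtinSchreier

open Polynomial

theorem exists_algebraMap_eq_of_pow_eq_self (F : Type*) {E : Type*} [Field F] [Field E]
    [Algebra F E] (p : ℕ) [Fact p.Prime] [CharP E p] {u : E} (hu : u ^ p = u) :
    ∃ c : F, algebraMap F E c = u :=
  (bot_le : ⊥ ≤ (algebraMap F E).fieldRange) ((Subfield.mem_bot_iff_pow_eq_self E p).mpr hu)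

theorem gal_X_pow_sub_X_sub_C_isSolvable {F : Type*} [Field F] (p : ℕ) [Fact p.Prime]
    [CharP F p] (a : F) : Group.IsSolvable (X ^ p - X - C a).Gal := by
  let E := (X ^ p - X - C a).SplittingField
  rw [← IsSplittingField.isSolvable_gal_iff E]
  have : CharP E p := charP_of_injective_algebraMap' F p
  have key (σ : Gal(E/F)) (b : E) (hb : aeval b (X ^ p - X - C a) = 0) :
      ∃ c : F, σ b = b + algebraMap F E c := by
    have hb' : b ^ p - b = algebraMap F E a := by
      simpa [sub_eq_zero] using hb
    obtain ⟨c, hc⟩ := exists_algebraMap_eq_of_pow_eq_self F p (u := σ b - b) (by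
      rw [sub_pow_char, ← map_pow, sub_eq_sub_iff_sub_eq_sub, ← map_sub, hb', AlgEquiv.commutes])
    exact ⟨c, by rw [hc, add_sub_cancel]⟩
  apply Group.isSolvable_of_comm
  intro σ τ
  refine AlgEquiv.coe_toAlgHom_injective (AlgHom.ext_of_adjoin_eq_top
    (IsSplittingField.adjoin_rootSet E (X ^ p - X - C a)) fun b hb ↦ ?_)
  replace hb := aeval_eq_zero_of_mem_rootSet hb
  obtain ⟨c, hc⟩ := key σ b hb
  obtain ⟨d, hd⟩ := key τ b hb
  change σ (τ b) = τ (σ b)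
  rw [hd, hc, map_add, map_add, hc, hd, σ.commutes, τ.commutes]
  exact add_right_comm _ _ _

theorem separable_X_pow_sub_X_sub_C {F : Type*} [Field F] (p : ℕ) [CharP F p] (a : F) :
    (X ^ p - X - C a).Separable := by
  refine ⟨0, -1, ?_⟩
  simp [derivative_X_pow]

end ArtinSchreier

section MaxSolvableExtClosed

open Polynomial IntermediateField

variable {K Ω : Type*} [Field K] [Field Ω] [Algebra K Ω] [Normal K Ω]

theorem mem_maxSolvableExt_of_aeval_mem {β : Ω} (g : K[X]) (hg : g.natDegree ≠ 0)
    (hgal : ∀ c : (minpoly K (aeval β g)).SplittingField,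
      Group.IsSolvable (g.map (algebraMap K _) - C c).Gal)
    (hsep : ∀ c : maxSolvableExt K Ω, aeval β g = c →
      (g.map (algebraMap K (maxSolvableExt K Ω)) - C c).Separable)
    (hβ : aeval β g ∈ maxSolvableExt K Ω) : β ∈ maxSolvableExt K Ω := by
  rw [mem_maxSolvableExt_iff]
  constructor
  · refine .of_algebra_isSeparable_of_isSeparable K (E := maxSolvableExt K Ω)
      ((hsep ⟨_, hβ⟩ rfl).of_dvd (minpoly.dvd _ _ ?_))
    rw [map_sub, aeval_map_algebraMap, aeval_C]
    exact sub_self _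
  · let p := minpoly K (aeval β g)
    have hα : Group.IsSolvable p.Gal := (mem_maxSolvableExt_iff.mp hβ).2
    have hp : p.comp g ≠ 0 := by
      intro h
      rcases comp_eq_zero_iff.mp h with h' | h'
      · exact minpoly.ne_zero (Normal.isIntegral inferInstance _) h'
      · exact hg (by rw [h'.2, natDegree_C])
    refine gal_isSolvable_of_splits (q := p.comp g)
      ⟨(SplittingField.splits (p.comp g)).of_dvd (map_ne_zero hp)
        ((map_dvd_map' _).mpr (minpoly.dvd K β (by rw [aeval_comp, minpoly.aeval])))⟩ ?_
    refine gal_isSolvable_tower p (p.comp g) (Gal.splits_in_splittingField_of_comp _ _ hg) hα ?_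
    obtain ⟨s, hs⟩ := splits_iff_exists_multiset.1 (SplittingField.splits p)
    rw [map_comp, hs, mul_comp, C_comp]
    apply gal_mul_isSolvable (gal_C_isSolvable _)
    rw [multiset_prod_comp]
    apply gal_prod_isSolvable
    intro q hq
    rw [Multiset.mem_map] at hq
    obtain ⟨q, hq, rfl⟩ := hq
    rw [Multiset.mem_map] at hq
    obtain ⟨q, _, rfl⟩ := hq
    rw [sub_comp, X_comp, C_comp]
    exact hgal q

theorem mem_maxSolvableExt_of_pow_mem {β : Ω} {n : ℕ} (hn : (n : K) ≠ 0)
    (hβ : β ^ n ∈ maxSolvableExt K Ω) : β ∈ maxSolvableExt K Ω := by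
  rcases eq_or_ne β 0 with rfl | hβ0
  · exact zero_mem _
  refine mem_maxSolvableExt_of_aeval_mem (X ^ n) ?_ (fun c ↦ ?_) (fun c hc ↦ ?_) (by simpa using hβ)
  · rw [natDegree_X_pow]
    rintro rfl
    simp at hn
  · rw [Polynomial.map_pow, map_X]
    exact gal_X_pow_sub_C_isSolvable n c
  · rw [Polynomial.map_pow, map_X]
    refine separable_X_pow_sub_C c ?_ ?_
    · rw [← map_natCast (algebraMap K _)]
      exact (_root_.map_ne_zero _).mpr hn
    · rintro rfl
      simp [hβ0] at hc

theorem mem_maxSolvableExt_of_pow_sub_mem {β : Ω} (p : ℕ) [hp : Fact p.Prime] [CharP K p]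
    (hβ : β ^ p - β ∈ maxSolvableExt K Ω) : β ∈ maxSolvableExt K Ω := by
  have : CharP (maxSolvableExt K Ω) p := charP_of_injective_algebraMap' K p
  refine mem_maxSolvableExt_of_aeval_mem (X ^ p - X) ?_ (fun c ↦ ?_) (fun c hc ↦ ?_)
    (by simpa using hβ)
  · rw [FiniteField.X_pow_card_sub_X_natDegree_eq _ hp.out.one_lt]
    exact hp.out.ne_zero
  · have : CharP (minpoly K (aeval β (X ^ p - X : K[X]))).SplittingField p :=
      charP_of_injective_algebraMap' K p
    rw [Polynomial.map_sub, Polynomial.map_pow, map_X]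
    exact gal_X_pow_sub_X_sub_C_isSolvable p c
  · rw [Polynomial.map_sub, Polynomial.map_pow, map_X]
    exact separable_X_pow_sub_X_sub_C p c

end MaxSolvableExtClosed

section CyclicExtensions

theorem Group.IsSolvable.exists_normal_prime_index (G : Type*) [Group G] [Finite G] [Nontrivial G]
    [Group.IsSolvable G] : ∃ H : Subgroup G, H.Normal ∧ H.index.Prime := by
  obtain ⟨H, hH, hGH⟩ := (IsCoatomic.eq_top_or_exists_le_coatom (commutator G)).resolve_left
    (Group.IsSolvable.commutator_lt_top_of_nontrivial G).ne
  have hn : H.Normal := .of_commutator_le _ hGH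
  refine ⟨H, hn, ?_⟩
  have hcomm : IsMulCommutative (G ⧸ H) :=
    Subgroup.Normal.quotient_commutative_iff_commutator_le.mpr hGH
  let : CommGroup (G ⧸ H) :=
    { QuotientGroup.Quotient.group H with mul_comm := hcomm.is_comm.comm }
  have hne : Nontrivial (G ⧸ H) := QuotientGroup.nontrivial_iff.mpr hH.1
  have hsimple : IsSimpleGroup (G ⧸ H) := by
    refine ⟨fun H' _ ↦ ?_⟩
    have hmk := QuotientGroup.mk'_surjective H
    have hle : H ≤ H'.comap (QuotientGroup.mk' H) := by
      conv_lhs => rw [← QuotientGroup.ker_mk' H]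
      exact MonoidHom.ker_le_comap _ _
    rcases hle.eq_or_lt with h | h
    · left
      rw [← Subgroup.map_comap_eq_self_of_surjective hmk H', ← h, QuotientGroup.map_mk'_self]
    · right
      rw [← Subgroup.map_comap_eq_self_of_surjective hmk H', hH.2 _ h,
        Subgroup.map_top_of_surjective _ hmk]
  exact IsSimpleGroup.prime_card (α := G ⧸ H)

open IntermediateField Module

variable {F E : Type*} [Field F] [Field E] [Algebra F E]

theorem exists_artinSchreier_generator_of_finrank_eq [FiniteDimensional F E] [IsGalois F E] {p : ℕ}
    [hp : Fact p.Prime] [CharP F p] (h : finrank F E = p) :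
    ∃ β : E, (∃ a : F, β ^ p - β = algebraMap F E a) ∧ β ∉ Set.range (algebraMap F E) := by
  have hcard : Nat.card Gal(E/F) = p := (IsGalois.card_aut_eq_finrank F E).trans h
  have hcyc : IsCyclic Gal(E/F) := isCyclic_of_prime_card hcard
  have : CharP E p := charP_of_injective_algebraMap' F p
  have : CharP (End F E) p := charP_of_injective_algebraMap' F p
  obtain ⟨σ, hσ⟩ := hcyc
  let T : End F E := σ.toLinearMap - 1
  have hT (x : E) : T x = σ x - x := rfl
  have hσp : σ ^ p = 1 := hcard ▸ pow_card_eq_one'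
  have hTp : T ^ p = 0 := by
    have hpow (n : ℕ) : σ.toLinearMap ^ n = (σ ^ n).toLinearMap := by
      induction n with
      | zero => rfl
      | succ n ih => rw [pow_succ, pow_succ, ih]; rfl
    rw [sub_pow_char_of_commute p (Commute.one_right _), one_pow, hpow, hσp]
    exact sub_self _
  have hT0 : T ≠ 0 := by
    intro hT0
    have hσ1 : σ = 1 := by
      ext x
      have := LinearMap.congr_fun hT0 x
      rw [hT, LinearMap.zero_apply, sub_eq_zero] at this
      exact this
    have := orderOf_eq_card_of_forall_mem_zpowers hσ
    rw [hσ1, orderOf_one, hcard] at this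
    exact hp.out.one_lt.ne this
  have hfix (x : E) (hx : σ x = x) : x ∈ Set.range (algebraMap F E) := by
    rw [IsGalois.mem_range_algebraMap_iff_fixed]
    intro τ
    obtain ⟨n, rfl⟩ := Subgroup.mem_zpowers_iff.mp (hσ τ)
    exact (MulAction.mem_stabilizer_iff (G := Gal(E/F)) (a := x)).mp
      ((MulAction.stabilizer Gal(E/F) x).zpow_mem hx n)
  obtain ⟨w, hw, hw2⟩ : ∃ w, T w ≠ 0 ∧ T (T w) = 0 := by
    classical
    have hex : ∃ n, T ^ n = 0 := ⟨p, hTp⟩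
    obtain ⟨n, hn⟩ : ∃ n, Nat.find hex = n + 2 := by
      refine Nat.exists_eq_add_of_le' ((Nat.le_find_iff hex 2).mpr fun m hm ↦ ?_)
      interval_cases m
      · simp
      · simpa using hT0
    have h1 : T ^ (n + 1) ≠ 0 := Nat.find_min hex (by lia)
    have h2 : T ^ (n + 2) = 0 := hn ▸ Nat.find_spec hex
    obtain ⟨v, hv⟩ := DFunLike.ne_iff.mp h1
    refine ⟨(T ^ n) v, ?_, ?_⟩
    · rwa [pow_succ'] at hv
    · have := LinearMap.congr_fun h2 v
      rwa [pow_succ', pow_succ'] at this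
  have hu : σ (T w) = T w := by rwa [hT, sub_eq_zero] at hw2
  have hw' : σ w = w + T w := by rw [hT]; ring
  have hβ : σ (w / T w) = w / T w + 1 := by
    rw [map_div₀, hu, hw', add_div, div_self hw]
  refine ⟨w / T w, ?_, ?_⟩
  · obtain ⟨a, ha⟩ := hfix ((w / T w) ^ p - w / T w) (by
      rw [map_sub, map_pow, hβ, add_pow_char, one_pow]; ring)
    exact ⟨a, ha.symm⟩
  · rintro ⟨a, ha⟩
    rw [← ha, σ.commutes] at hβ
    simp at hβ

/-- A field with all the roots needed to solve cyclic extensions of prime degree: roots of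
unity, radicals, and solutions of Artin-Schreier equations. -/
structure HasCyclicRoots (F : Type*) [Field F] : Prop where
  exists_isPrimitiveRoot (n : ℕ) (_ : (n : F) ≠ 0) : ∃ ζ : F, IsPrimitiveRoot ζ n
  exists_pow_eq (n : ℕ) (_ : (n : F) ≠ 0) (a : F) : ∃ b, b ^ n = a
  exists_pow_sub_eq (p : ℕ) (_ : p.Prime) (_ : (p : F) = 0) (a : F) : ∃ b, b ^ p - b = a

theorem HasCyclicRoots.not_prime_finrank [FiniteDimensional F E] [IsGalois F E]
    (hF : HasCyclicRoots F) : ¬ (finrank F E).Prime := by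
  intro hℓ
  have hfact : Fact (finrank F E).Prime := ⟨hℓ⟩
  by_cases hchar : (finrank F E : F) = 0
  · have : CharP F (finrank F E) := (CharP.charP_iff_prime_eq_zero hℓ).mpr hchar
    have : CharP E (finrank F E) := charP_of_injective_algebraMap' F _
    obtain ⟨β, ⟨a, ha⟩, hβ⟩ := exists_artinSchreier_generator_of_finrank_eq (F := F) (E := E) rfl
    obtain ⟨b, rfl⟩ := hF.exists_pow_sub_eq _ hℓ hchar a
    obtain ⟨c, hc⟩ := exists_algebraMap_eq_of_pow_eq_self F (finrank F E)
      (u := β - algebraMap F E b) (by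
        rw [sub_pow_char, sub_eq_sub_iff_sub_eq_sub, ha, map_sub, map_pow])
    exact hβ ⟨c + b, by rw [map_add, hc, sub_add_cancel]⟩
  · have : IsCyclic Gal(E/F) :=
      isCyclic_of_prime_card (IsGalois.card_aut_eq_finrank F E)
    obtain ⟨ζ, hζ⟩ := hF.exists_isPrimitiveRoot _ hchar
    obtain ⟨α, ⟨a, ha⟩, hα⟩ := exists_root_adjoin_eq_top_of_isCyclic F E
      ⟨ζ, (mem_primitiveRoots hℓ.pos).mpr hζ⟩
    obtain ⟨b, rfl⟩ := hF.exists_pow_eq _ hchar a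
    have hmem : α ∈ (⊥ : IntermediateField F E) := by
      rw [map_pow] at ha
      have hζ' := hζ.map_of_injective (algebraMap F E).injective
      rcases eq_or_ne b 0 with rfl | hb
      · rw [map_zero, zero_pow hℓ.ne_zero] at ha
        rw [eq_zero_of_pow_eq_zero ha.symm]
        exact zero_mem _
      have hb' : algebraMap F E b ≠ 0 := (map_ne_zero _).mpr hb
      obtain ⟨i, -, hi⟩ := hζ'.eq_pow_of_pow_eq_one (ξ := α / algebraMap F E b) (by
        rw [div_pow, ← ha, div_self (pow_ne_zero _ hb')])
      rw [eq_div_iff hb', ← map_pow, ← map_mul] at hi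
      exact mem_bot.mpr ⟨_, hi⟩
    rw [adjoin_simple_eq_bot_iff.mpr hmem] at hα
    have h := IntermediateField.finrank_top' (F := F) (E := E)
    rw [← hα, IntermediateField.finrank_bot] at h
    exact hℓ.one_lt.ne h

/-- A field with enough roots has no nontrivial solvable Galois extensions. -/
theorem HasCyclicRoots.mem_range_algebraMap [FiniteDimensional F E] [IsGalois F E]
    (hF : HasCyclicRoots F) (hE : Group.IsSolvable Gal(E/F)) (x : E) :
    x ∈ Set.range (algebraMap F E) := by
  rcases subsingleton_or_nontrivial Gal(E/F) with h | h
  · rw [IsGalois.mem_range_algebraMap_iff_fixed]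
    intro σ
    rw [Subsingleton.elim σ 1]
    rfl
  · obtain ⟨H, hn, hH⟩ := Group.IsSolvable.exists_normal_prime_index Gal(E/F)
    refine absurd ?_ (hF.not_prime_finrank (E := fixedField H))
    rwa [finrank_eq_fixingSubgroup_index, fixingSubgroup_fixedField]

end CyclicExtensions

section ResidueFieldRoots

open Polynomial IsLocalRing

theorem one_add_mul_pow_succ_eq {R : Type*} [CommRing R] {m : ℕ} (hm : (m + 1).Prime) {l : R}
    (hl : l ^ m = -(m + 1 : ℕ)) (z : R) :
    (1 + l * z) ^ (m + 1) = 1 + l ^ (m + 1) *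
      (z ^ (m + 1) -
        ∑ i ∈ Finset.range m, ((m + 1).choose (i + 1) / (m + 1) : ℕ) * l ^ i * z ^ (i + 1)) := by
  rw [add_comm, add_pow, Finset.sum_range_succ, Finset.sum_range_succ', mul_sub, Finset.mul_sum,
    ← sub_eq_zero]
  have h (i : ℕ) (hi : i ∈ Finset.range m) :
      (l * z) ^ (i + 1) * 1 ^ (m + 1 - (i + 1)) * ((m + 1).choose (i + 1) : R) =
        -(l ^ (m + 1) * (((m + 1).choose (i + 1) / (m + 1) : ℕ) * l ^ i * z ^ (i + 1))) := by
    obtain ⟨c, hc⟩ := hm.dvd_choose_self (Nat.succ_ne_zero i)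
      (by have := Finset.mem_range.mp hi; lia)
    rw [hc, Nat.mul_div_cancel_left _ hm.pos, Nat.cast_mul, ← neg_eq_iff_eq_neg.mpr hl,
      pow_succ l m]
    ring
  rw [Finset.sum_congr rfl h, Finset.sum_neg_distrib]
  simp
  ring

theorem HasCyclicRoots.residueField {N B : Type*} [Field N] [CommRing B] [IsLocalRing B]
    [Algebra B N] [IsFractionRing B N] [IsIntegrallyClosed B] (hN : HasCyclicRoots N) :
    HasCyclicRoots (ResidueField B) := by
  have hinj : Function.Injective (algebraMap B N) := IsFractionRing.injective B N
  have hdom : IsDomain B := hinj.isDomain (algebraMap B N)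
  have hchar {n : ℕ} (hn : (n : ResidueField B) ≠ 0) : (n : N) ≠ 0 := by
    intro h
    rw [← map_natCast (algebraMap B N), map_eq_zero_iff _ hinj] at h
    rw [← map_natCast (residue B), h, map_zero] at hn
    exact hn rfl
  have hlift {z : N} (hz : IsIntegral B z) : ∃ b : B, algebraMap B N b = z :=
    IsIntegrallyClosed.isIntegral_iff.mp hz
  have hpow {n : ℕ} (hn : n ≠ 0) (hn' : (n : N) ≠ 0) (a : B) : ∃ b : B, b ^ n = a := by
    obtain ⟨b, hb⟩ := hN.exists_pow_eq n hn' (algebraMap B N a)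
    obtain ⟨b, rfl⟩ := hlift (.of_pow (Nat.pos_of_ne_zero hn) (hb ▸ isIntegral_algebraMap))
    exact ⟨b, hinj (by rw [map_pow, hb])⟩
  refine ⟨fun n hn ↦ ?_, fun n hn a ↦ ?_, fun p hp hp0 a ↦ ?_⟩
  · have hn0 : n ≠ 0 := by rintro rfl; simp at hn
    obtain ⟨ζ, hζ⟩ := hN.exists_isPrimitiveRoot n (hchar hn)
    obtain ⟨ζ, rfl⟩ := hlift (.of_pow (Nat.pos_of_ne_zero hn0)
      (hζ.pow_eq_one ▸ isIntegral_one))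
    have : NeZero (n : ResidueField B) := ⟨hn⟩
    have hroot := (hζ.of_map_of_injective hinj).isRoot_cyclotomic (Nat.pos_of_ne_zero hn0)
    refine ⟨residue B ζ, isRoot_cyclotomic_iff.mp ?_⟩
    rw [← map_cyclotomic n (residue B)]
    exact hroot.map
  · have hn0 : n ≠ 0 := by rintro rfl; simp at hn
    obtain ⟨a, rfl⟩ := residue_surjective a
    obtain ⟨b, rfl⟩ := hpow hn0 (hchar hn) a
    exact ⟨residue B b, (map_pow _ _ _).symm⟩
  · obtain ⟨a, rfl⟩ := residue_surjective a
    obtain ⟨m, rfl⟩ : ∃ m, p = m + 1 := Nat.exists_eq_add_of_le' hp.one_lt.le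
    have hm : 1 ≤ m := Nat.le_of_lt_succ hp.one_lt
    by_cases hpN : ((m + 1 : ℕ) : N) = 0
    · obtain ⟨z, hz⟩ := hN.exists_pow_sub_eq _ hp hpN (algebraMap B N a)
      have hmonic : (X ^ (m + 1) - (X + C a)).Monic := by
        refine monic_X_pow_sub (((degree_add_le _ _).trans (max_le ?_ ?_)).trans_lt
          (show (m : WithBot ℕ) < (m + 1 : ℕ) by exact_mod_cast Nat.lt_succ_self m))
        · exact degree_X_le.trans (by exact_mod_cast hm)
        · exact degree_C_le.trans (by exact_mod_cast zero_le)
      obtain ⟨z, rfl⟩ := hlift ⟨_, hmonic, show aeval z _ = 0 by simp [← hz]⟩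
      refine ⟨residue B z, ?_⟩
      rw [← map_pow, ← map_sub]
      exact congrArg _ (hinj (by rw [map_sub, map_pow, hz]))
    · have hmk : (m : ResidueField B) ≠ 0 := by
        intro h
        rw [Nat.cast_succ, h, zero_add] at hp0
        exact one_ne_zero hp0
      obtain ⟨l, hl⟩ := hpow (Nat.one_le_iff_ne_zero.mp hm) (hchar hmk) (-(m + 1 : ℕ))
      have hl0 : algebraMap B N l ≠ 0 := by
        intro h
        rw [map_eq_zero_iff _ hinj] at h
        rw [h, zero_pow (Nat.one_le_iff_ne_zero.mp hm), eq_comm, neg_eq_zero] at hl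
        exact hpN (by rw [← map_natCast (algebraMap B N), hl, map_zero])
      have hres : residue B l = 0 := by
        have := congrArg (residue B) hl
        rw [map_pow, map_neg, map_natCast, hp0, neg_zero] at this
        exact eq_zero_of_pow_eq_zero this
      obtain ⟨y, hy⟩ := hN.exists_pow_eq _ hpN (algebraMap B N (1 + l ^ (m + 1) * a))
      let c (i : ℕ) : ℕ := (m + 1).choose (i + 1) / (m + 1)
      obtain ⟨z, rfl⟩ : ∃ z, y = 1 + algebraMap B N l * z :=
        ⟨(y - 1) / algebraMap B N l, by rw [mul_div_cancel₀ _ hl0]; ring⟩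
      have hlN : algebraMap B N l ^ m = -(m + 1 : ℕ) := by
        rw [← map_pow, hl, map_neg, map_natCast]
      rw [one_add_mul_pow_succ_eq hp hlN, map_add, map_one, add_right_inj, map_mul, map_pow,
        mul_right_inj' (pow_ne_zero _ hl0)] at hy
      have hmonic : (X ^ (m + 1) -
          (∑ i ∈ Finset.range m, C ((c i : B) * l ^ i) * X ^ (i + 1) + C a)).Monic := by
        refine monic_X_pow_sub (((degree_add_le _ _).trans (max_le ?_ ?_)).trans_lt
          (show (m : WithBot ℕ) < (m + 1 : ℕ) by exact_mod_cast Nat.lt_succ_self m))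
        · refine (degree_sum_le _ _).trans (Finset.sup_le fun i hi ↦ ?_)
          refine (degree_C_mul_X_pow_le _ _).trans ?_
          exact_mod_cast Nat.succ_le_of_lt (Finset.mem_range.mp hi)
        · exact degree_C_le.trans (by exact_mod_cast zero_le)
      obtain ⟨z, rfl⟩ := hlift ⟨_, hmonic, show aeval z _ = 0 by
        simp [← hy, aeval_def, eval₂_finsetSum, c]⟩
      refine ⟨residue B z, ?_⟩
      have hB : z ^ (m + 1) - ∑ i ∈ Finset.range m, (c i : B) * l ^ i * z ^ (i + 1) = a :=
        hinj (by rw [← hy]; simp [c])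
      have := congrArg (residue B) hB
      rw [map_sub, map_pow, map_sum, Finset.sum_eq_single 0] at this
      · simpa [c] using this
      · intro i _ hi
        simp [hres, hi]
      · intro h
        simp at h
        lia

end ResidueFieldRoots

section SplittingOverCyclicRoots

open Polynomial IntermediateField

theorem hasCyclicRoots_maxSolvableExt (K Ω : Type*) [Field K] [Field Ω] [Algebra K Ω] [Normal K Ω]
    [IsAlgClosed Ω] : HasCyclicRoots (maxSolvableExt K Ω) := by
  have hcast {n : ℕ} (hn : (n : maxSolvableExt K Ω) ≠ 0) : (n : K) ≠ 0 := by
    rwa [← map_natCast (algebraMap K (maxSolvableExt K Ω)), _root_.map_ne_zero] at hn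
  refine ⟨fun n hn ↦ ?_, fun n hn a ↦ ?_, fun p hp hp0 a ↦ ?_⟩
  · have hn0 : (n : Ω) ≠ 0 := by
      rw [← map_natCast (algebraMap K Ω)]
      exact (_root_.map_ne_zero _).mpr (hcast hn)
    have : NeZero (n : Ω) := ⟨hn0⟩
    obtain ⟨ζ, hζ⟩ := HasEnoughRootsOfUnity.exists_primitiveRoot Ω n
    have hmem : ζ ∈ maxSolvableExt K Ω :=
      mem_maxSolvableExt_of_pow_mem (hcast hn) (hζ.pow_eq_one ▸ one_mem _)
    exact ⟨⟨ζ, hmem⟩, .of_map_of_injective (f := algebraMap (maxSolvableExt K Ω) Ω) hζ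
      (algebraMap (maxSolvableExt K Ω) Ω).injective⟩
  · have hn0 : n ≠ 0 := by rintro rfl; simp at hn
    obtain ⟨b, hb⟩ := IsAlgClosed.exists_pow_nat_eq (a : Ω) (Nat.pos_of_ne_zero hn0)
    exact ⟨⟨b, mem_maxSolvableExt_of_pow_mem (hcast hn) (hb ▸ a.2)⟩, Subtype.ext hb⟩
  · have : Fact p.Prime := ⟨hp⟩
    have hpK : (p : K) = 0 := not_not.mp fun h ↦ by
      rw [← map_natCast (algebraMap K _), map_eq_zero] at hp0
      exact h hp0
    have : CharP K p := (CharP.charP_iff_prime_eq_zero hp).mpr hpK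
    obtain ⟨b, hb⟩ := IsAlgClosed.exists_root (X ^ p - X - C (a : Ω)) (by
      have hd : (X + C (a : Ω)).degree < (X ^ p : Polynomial Ω).degree := by
        rw [degree_X_add_C, degree_X_pow]
        exact_mod_cast hp.one_lt
      rw [sub_sub, degree_sub_eq_left_of_degree_lt hd, degree_X_pow]
      exact_mod_cast hp.ne_zero)
    have hb' : b ^ p - b = a := by simpa [sub_eq_zero] using hb
    exact ⟨⟨b, mem_maxSolvableExt_of_pow_sub_mem p (hb' ▸ a.2)⟩, Subtype.ext hb'⟩

theorem Polynomial.isSolvable_gal_map {k F : Type*} [Field k] [Field F] [Algebra k F] (f : k[X])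
    (hf : Group.IsSolvable f.Gal) : Group.IsSolvable (f.map (algebraMap k F)).Gal := by
  let E := (f.map (algebraMap k F)).SplittingField
  have hsplits : (f.map (algebraMap k E)).Splits := by
    rw [IsScalarTower.algebraMap_eq k F E, ← Polynomial.map_map]
    exact SplittingField.splits _
  have : Fact ((f.map (algebraMap k E)).Splits) := ⟨hsplits⟩
  rw [← IsSplittingField.isSolvable_gal_iff E]
  let ϕ : Gal(E/F) →* f.Gal := (Gal.restrict f E).comp (AlgEquiv.restrictScalarsHom k)
  refine Group.isSolvable_of_isSolvable_injective (f := ϕ) fun σ τ h ↦ ?_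
  refine AlgEquiv.coe_toAlgHom_injective (AlgHom.ext_of_adjoin_eq_top
    (IsSplittingField.adjoin_rootSet E (f.map (algebraMap k F))) fun x hx ↦ ?_)
  rw [mem_rootSet', Polynomial.map_map, ← IsScalarTower.algebraMap_eq, aeval_map_algebraMap,
    ← mem_rootSet'] at hx
  have key (ρ : Gal(E/F)) : ((ϕ ρ • (⟨x, hx⟩ : f.rootSet E) : f.rootSet E) : E) = ρ x :=
    Gal.restrict_smul (ρ.restrictScalars k) _
  exact (key σ).symm.trans (h ▸ key τ)

theorem HasCyclicRoots.exists_aeval_eq_zero {k F : Type*} [Field k] [Field F] [Algebra k F]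
    (hF : HasCyclicRoots F) {f : k[X]} (hsep : f.Separable) (hsol : Group.IsSolvable f.Gal)
    (hdeg : f.degree ≠ 0) : ∃ x : F, aeval x f = 0 := by
  let E := (f.map (algebraMap k F)).SplittingField
  have : IsGalois F E := .of_separable_splitting_field (p := f.map (algebraMap k F)) hsep.map
  have : FiniteDimensional F E := IsSplittingField.finiteDimensional E (f.map (algebraMap k F))
  obtain ⟨y, hy⟩ := (SplittingField.splits (f.map (algebraMap k F))).exists_eval_eq_zero
    (by rwa [degree_map, degree_map])
  obtain ⟨x, rfl⟩ := hF.mem_range_algebraMap (E := E) ((IsSplittingField.isSolvable_gal_iff E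
    (f.map (algebraMap k F))).mpr (Polynomial.isSolvable_gal_map f hsol)) y
  refine ⟨x, (algebraMap F E).injective ?_⟩
  rw [map_zero, ← hy, eval_map_algebraMap, aeval_map_algebraMap, aeval_algebraMap_apply]

end SplittingOverCyclicRoots

section Composite

open IsLocalRing Polynomial

theorem isIntegral_residue_of_isIntegralElem {R S B : Type*} [CommRing R] [CommRing S]
    [CommRing B] [IsLocalRing B] [Algebra S (ResidueField B)] {φ : R →+* B} {π : R →+* S}
    (h : (residue B).comp φ = (algebraMap S (ResidueField B)).comp π) {b : B}
    (hb : φ.IsIntegralElem b) : IsIntegral S (residue B b) := by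
  obtain ⟨p, hp, hpb⟩ := hb
  refine ⟨p.map π, hp.map π, ?_⟩
  rw [eval₂_map, ← h, ← hom_eval₂, hpb, map_zero]

theorem IsIntegral.exists_eval₂_mem_maximalIdeal {R S B : Type*} [CommRing R] [CommRing S]
    [CommRing B] [IsLocalRing B] [Algebra S (ResidueField B)] {φ : R →+* B} {π : R →+* S}
    (h : (residue B).comp φ = (algebraMap S (ResidueField B)).comp π)
    (hπ : Function.Surjective π) {b : B} (hb : IsIntegral S (residue B b)) :
    ∃ g : R[X], g.Monic ∧ g.eval₂ φ b ∈ maximalIdeal B := by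
  obtain ⟨p, hp, hpb⟩ := hb
  obtain ⟨g, rfl, -, hg⟩ := lifts_and_natDegree_eq_and_monic (f := π)
    ((mem_lifts p).mpr (map_surjective π hπ p)) hp
  refine ⟨g, hg, (residue_eq_zero_iff _).mp ?_⟩
  rw [hom_eval₂, h, ← eval₂_map, hpb]

theorem isIntegral_or_isIntegral_inv_of_aeval_eq_zero {R k L L' : Type*} [CommRing R] [Field k]
    [Field L] [Field L'] [Algebra R k] [Algebra k L] [Algebra k L'] [Algebra R L] [Algebra R L']
    [IsScalarTower R k L] [IsScalarTower R k L'] {f : k[X]} (hf : Irreducible f) {x : L} {x' : L'}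
    (hx : aeval x f = 0) (hx' : aeval x' f = 0) (h : IsIntegral R x ∨ IsIntegral R x⁻¹) :
    IsIntegral R x' ∨ IsIntegral R x'⁻¹ := by
  have : Fact (Irreducible f) := ⟨hf⟩
  let φ := AdjoinRoot.liftAlgHom f (Algebra.ofId k L) x hx
  let φ' := AdjoinRoot.liftAlgHom f (Algebra.ofId k L') x' hx'
  have e : φ (AdjoinRoot.root f) = x := AdjoinRoot.liftAlgHom_root ..
  have e' : φ' (AdjoinRoot.root f) = x' := AdjoinRoot.liftAlgHom_root ..
  have key (y : AdjoinRoot f) : IsIntegral R (φ y) ↔ IsIntegral R y :=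
    isIntegral_algHom_iff (φ.restrictScalars R) φ.injective
  have key' (y : AdjoinRoot f) : IsIntegral R (φ' y) ↔ IsIntegral R y :=
    isIntegral_algHom_iff (φ'.restrictScalars R) φ'.injective
  rwa [← e', ← map_inv₀, key', key', ← key, ← key, map_inv₀, e]

namespace ValuationSubring

variable {K : Type*} [Field K] {O₁ O₂ : ValuationSubring K}

theorem mem_of_mem_maximalIdeal_of_le (h : O₁ ≤ O₂) {y : O₂} (hy : y ∈ maximalIdeal O₂) :
    (y : K) ∈ O₁ := by
  by_contra hyO
  have hy0 : (y : K) ≠ 0 := fun h0 ↦ hyO (h0 ▸ O₁.zero_mem)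
  have hinv : (y : K)⁻¹ ∈ O₂ := h ((O₁.mem_or_inv_mem _).resolve_left hyO)
  rw [mem_maximalIdeal, _root_.mem_nonunits_iff] at hy
  exact hy (.of_mul_eq_one ⟨_, hinv⟩ (Subtype.ext (mul_inv_cancel₀ hy0)))

theorem exists_coe_eq_image_residue (O₁ O₂ : ValuationSubring K) (h : O₁ ≤ O₂) :
    ∃ Obar : ValuationSubring (ResidueField O₂),
      (Obar : Set (ResidueField O₂)) = residue O₂ '' {x : O₂ | (x : K) ∈ O₁} := by
  refine ⟨⟨(O₁.toSubring.comap O₂.subtype).map (residue O₂), fun x ↦ ?_⟩, rfl⟩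
  obtain ⟨x, rfl⟩ := residue_surjective x
  rcases eq_or_ne (residue O₂ x) 0 with h0 | h0
  · exact .inl (h0 ▸ Subring.zero_mem _)
  rcases O₁.mem_or_inv_mem x with hx | hx
  · exact .inl ⟨x, hx, rfl⟩
  · refine .inr ⟨⟨_, h hx⟩, hx, eq_inv_of_mul_eq_one_left ?_⟩
    rw [← map_mul, ← map_one (residue O₂)]
    refine congrArg _ (Subtype.ext (inv_mul_cancel₀ fun hx0 ↦ h0 ?_))
    rw [ZeroMemClass.coe_eq_zero.mp hx0, map_zero]

variable {Obar : ValuationSubring (ResidueField O₂)}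

/-- The residue map of a coarsening of `O₁`, restricted to `O₁`. -/
def toImageResidue (h : O₁ ≤ O₂)
    (hO : (Obar : Set (ResidueField O₂)) = residue O₂ '' {x : O₂ | (x : K) ∈ O₁}) : O₁ →+* Obar :=
  ((residue O₂).comp (O₁.inclusion O₂ h)).codRestrict Obar.toSubring fun x ↦
    show residue O₂ _ ∈ (Obar : Set (ResidueField O₂)) from
      hO ▸ Set.mem_image_of_mem _ x.2

theorem toImageResidue_surjective (h : O₁ ≤ O₂)
    (hO : (Obar : Set (ResidueField O₂)) = residue O₂ '' {x : O₂ | (x : K) ∈ O₁}) :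
    Function.Surjective (toImageResidue h hO) := by
  rintro ⟨y, hy⟩
  obtain ⟨x, hx, rfl⟩ : y ∈ residue O₂ '' {x : O₂ | (x : K) ∈ O₁} := hO ▸ hy
  exact ⟨⟨x, hx⟩, rfl⟩

theorem residue_comp_eq_algebraMap_comp_toImageResidue (h : O₁ ≤ O₂)
    (hO : (Obar : Set (ResidueField O₂)) = residue O₂ '' {x : O₂ | (x : K) ∈ O₁})
    {B : Type*} [CommRing B] [IsLocalRing B] [Algebra O₂ B] [IsLocalHom (algebraMap O₂ B)] :
    (residue B).comp ((algebraMap O₂ B).comp (O₁.inclusion O₂ h)) =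
      (algebraMap Obar (ResidueField B)).comp (toImageResidue h hO) :=
  rfl

end ValuationSubring

end Composite

section Dichotomy

open IsLocalRing Polynomial

theorem IsLocalRing.maximalIdeal_le_radical_map {A B : Type*} [CommRing A] [IsLocalRing A]
    [CommRing B] [IsLocalRing B] [Algebra A B] [Algebra.IsIntegral A B] :
    maximalIdeal B ≤ ((maximalIdeal A).map (algebraMap A B)).radical := by
  rw [Ideal.radical_eq_sInf]
  refine le_sInf ?_
  rintro J ⟨hJ, hJp⟩
  have hcomap : J.comap (algebraMap A B) = maximalIdeal A :=
    ((maximalIdeal.isMaximal A).eq_of_le (Ideal.comap_ne_top _ hJp.ne_top)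
      (Ideal.map_le_iff_le_comap.mp hJ)).symm
  have : J.IsMaximal := Ideal.isMaximal_of_isIntegral_of_isMaximal_comap (R := A) J
    (hcomap ▸ maximalIdeal.isMaximal A)
  exact (eq_maximalIdeal this).ge

namespace ValuationSubring

variable {K : Type*} [Field K] {O₁ O₂ : ValuationSubring K} {L : Type*} [Field L] [Algebra K L]

theorem isIntegral_of_le (h : O₁ ≤ O₂) {x : L} (hx : IsIntegral O₁ x) : IsIntegral O₂ x := by
  obtain ⟨p, hp, hpx⟩ := hx
  exact ⟨p.map (O₁.inclusion O₂ h), hp.map _, by rw [eval₂_map]; exact hpx⟩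

theorem isIntegral_mul_of_mem_maximalIdeal (h : O₁ ≤ O₂) {c : O₂} (hc : c ∈ maximalIdeal O₂)
    {z : L} (hz : IsIntegral O₂ z) : IsIntegral O₁ (algebraMap O₂ L c * z) := by
  obtain ⟨p, hp, hpz⟩ := hz
  have hroot : aeval (algebraMap O₂ L c * z) (p.scaleRoots c) = 0 :=
    scaleRoots_aeval_eq_zero hpz
  have hmem (i : ℕ) : ((p.scaleRoots c).coeff i : K) ∈ O₁ := by
    rw [coeff_scaleRoots]
    rcases lt_trichotomy i p.natDegree with hi | rfl | hi
    · refine mem_of_mem_maximalIdeal_of_le h (Ideal.mul_mem_left _ _ ?_)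
      exact Ideal.pow_mem_of_mem _ hc _ (Nat.sub_pos_of_lt hi)
    · rw [Nat.sub_self, pow_zero, mul_one, hp.coeff_natDegree]
      exact O₁.one_mem
    · rw [coeff_eq_zero_of_natDegree_lt hi, zero_mul]
      exact O₁.zero_mem
  have hlift : p.scaleRoots c ∈ lifts (O₁.inclusion O₂ h) :=
    (lifts_iff_coeff_lifts _).mpr fun i ↦ ⟨⟨_, hmem i⟩, Subtype.ext rfl⟩
  obtain ⟨g, hg, -, hgm⟩ := lifts_and_natDegree_eq_and_monic hlift ((monic_scaleRoots_iff c).mpr hp)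
  refine ⟨g, hgm, ?_⟩
  rw [← hg, aeval_def, eval₂_map] at hroot
  exact hroot

variable {B : Type*} [CommRing B] [Algebra O₂ B] [Algebra B L] [IsScalarTower O₂ B L]

theorem isIntegral_algebraMap_of_mem_map_maximalIdeal (h : O₁ ≤ O₂) [Algebra.IsIntegral O₂ B]
    {b : B} (hb : b ∈ (maximalIdeal O₂).map (algebraMap O₂ B)) :
    IsIntegral O₁ (algebraMap B L b) := by
  rw [Ideal.map, Ideal.span] at hb
  induction hb using Submodule.closure_induction with
  | zero => rw [map_zero]; exact isIntegral_zero
  | add x y _ _ hx hy => rw [map_add]; exact hx.add hy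
  | smul_mem r x hx =>
    obtain ⟨c, hc, rfl⟩ := hx
    rw [smul_eq_mul, map_mul, mul_comm, ← IsScalarTower.algebraMap_apply]
    exact isIntegral_mul_of_mem_maximalIdeal h hc
      ((Algebra.IsIntegral.isIntegral (R := O₂) r).algebraMap)

variable [IsLocalRing B]

theorem isIntegral_algebraMap_of_mem_maximalIdeal (h : O₁ ≤ O₂) [IsIntegralClosure B O₂ L]
    {b : B} (hb : b ∈ maximalIdeal B) :
    IsIntegral O₁ (algebraMap B L b) := by
  have : Algebra.IsIntegral O₂ B := IsIntegralClosure.isIntegral_algebra O₂ L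
  obtain ⟨n, hn⟩ := IsLocalRing.maximalIdeal_le_radical_map (A := O₂) hb
  refine .of_pow n.succ_pos ?_
  rw [← map_pow, pow_succ]
  exact isIntegral_algebraMap_of_mem_map_maximalIdeal h (Ideal.mul_mem_right _ _ hn)

variable {Obar : ValuationSubring (ResidueField O₂)} [IsLocalHom (algebraMap O₂ B)]

theorem isIntegral_residue (h : O₁ ≤ O₂)
    (hO : (Obar : Set (ResidueField O₂)) = residue O₂ '' {x : O₂ | (x : K) ∈ O₁})
    [IsIntegralClosure B O₂ L] {b : B} (hb : IsIntegral O₁ (algebraMap B L b)) :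
    IsIntegral Obar (residue B b) := by
  obtain ⟨p, hp, hpb⟩ := hb
  refine isIntegral_residue_of_isIntegralElem
    (residue_comp_eq_algebraMap_comp_toImageResidue h hO) ⟨p, hp, ?_⟩
  apply IsIntegralClosure.algebraMap_injective B O₂ L
  rw [hom_eval₂, ← RingHom.comp_assoc, ← IsScalarTower.algebraMap_eq, map_zero]
  exact hpb

theorem isIntegral_algebraMap_of_isIntegral_residue (h : O₁ ≤ O₂)
    (hO : (Obar : Set (ResidueField O₂)) = residue O₂ '' {x : O₂ | (x : K) ∈ O₁})
    [IsIntegralClosure B O₂ L] {b : B} (hb : IsIntegral Obar (residue B b)) :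
    IsIntegral O₁ (algebraMap B L b) := by
  obtain ⟨g, hg, hgb⟩ := hb.exists_eval₂_mem_maximalIdeal
    (residue_comp_eq_algebraMap_comp_toImageResidue h hO) (toImageResidue_surjective h hO)
  refine .of_aeval_monic hg (fun hdeg ↦ ?_) ?_
  · rw [hg.natDegree_eq_zero.mp hdeg, eval₂_one] at hgb
    exact (Ideal.ne_top_iff_one _).mp (maximalIdeal.isMaximal B).ne_top hgb
  · have := isIntegral_algebraMap_of_mem_maximalIdeal (L := L) h hgb
    rw [hom_eval₂, ← RingHom.comp_assoc, ← IsScalarTower.algebraMap_eq] at this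
    exact this

theorem dichotomy_residueField (h : O₁ ≤ O₂)
    (hO : (Obar : Set (ResidueField O₂)) = residue O₂ '' {x : O₂ | (x : K) ∈ O₁})
    [IsIntegralClosure B O₂ L]
    (hL : ∀ x : L, IsIntegral O₁ x ∨ IsIntegral O₁ x⁻¹)
    (z : ResidueField B) : IsIntegral Obar z ∨ IsIntegral Obar z⁻¹ := by
  obtain ⟨b, rfl⟩ := residue_surjective z
  rcases hL (algebraMap B L b) with hb | hb
  · exact .inl (isIntegral_residue h hO hb)
  rcases eq_or_ne (algebraMap B L b) 0 with h0 | h0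
  · obtain rfl : b = 0 :=
      IsIntegralClosure.algebraMap_injective B O₂ L (h0.trans (map_zero _).symm)
    rw [map_zero]
    exact .inl isIntegral_zero
  obtain ⟨c, hc⟩ := (IsIntegralClosure.isIntegral_iff (A := B)).mp (isIntegral_of_le h hb)
  have hcb : c * b = 1 := by
    apply IsIntegralClosure.algebraMap_injective B O₂ L
    rw [map_mul, hc, inv_mul_cancel₀ h0, map_one]
  refine .inr ?_
  rw [← eq_inv_of_mul_eq_one_left (a := residue B c) (by rw [← map_mul, hcb, map_one])]
  exact isIntegral_residue h hO (hc ▸ hb)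

/-- The dichotomy "`x` or `x⁻¹` is integral" for a composite valuation ring. -/
theorem dichotomy_of_residueField (h : O₁ ≤ O₂)
    (hO : (Obar : Set (ResidueField O₂)) = residue O₂ '' {x : O₂ | (x : K) ∈ O₁})
    [IsIntegralClosure B O₂ L]
    (hL : ∀ x : L, IsIntegral O₂ x ∨ IsIntegral O₂ x⁻¹)
    (hres : ∀ z : ResidueField B, IsIntegral Obar z ∨ IsIntegral Obar z⁻¹)
    (x : L) : IsIntegral O₁ x ∨ IsIntegral O₁ x⁻¹ := by
  wlog hx : IsIntegral O₂ x generalizing x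
  · simpa [or_comm] using this x⁻¹ ((hL x).resolve_left hx)
  obtain ⟨b, rfl⟩ := (IsIntegralClosure.isIntegral_iff (A := B)).mp hx
  by_cases hb : IsUnit b
  · obtain ⟨c, hc⟩ := hb.exists_left_inv
    refine (hres (residue B b)).imp (isIntegral_algebraMap_of_isIntegral_residue h hO) fun hr ↦ ?_
    rw [← eq_inv_of_mul_eq_one_left (a := algebraMap B L c) (by rw [← map_mul, hc, map_one])]
    refine isIntegral_algebraMap_of_isIntegral_residue h hO ?_
    rwa [eq_inv_of_mul_eq_one_left (a := residue B c) (b := residue B b)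
      (by rw [← map_mul, hc, map_one])]
  · exact .inl (isIntegral_algebraMap_of_mem_maximalIdeal h ((mem_maximalIdeal b).mpr hb))

end ValuationSubring

end Dichotomy

section ResidueFieldGalois

open IsLocalRing

namespace IsLocalRing.ResidueField

variable {A B : Type*} [CommRing A] [IsLocalRing A] [CommRing B] [IsLocalRing B] [Algebra A B]
  [IsLocalHom (algebraMap A B)] (G : Type*) [Group G] [Finite G] [MulSemiringAction G B]
  [Algebra.IsInvariant A B G]

theorem normal_and_isSolvable_of_isInvariant [SMulCommClass G A B] (hG : Group.IsSolvable G) :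
    Normal (ResidueField A) (ResidueField B) ∧
      Group.IsSolvable Gal(ResidueField B/ResidueField A) := by
  let : Field (A ⧸ maximalIdeal A) := Ideal.Quotient.field _
  let : Field (B ⧸ maximalIdeal B) := Ideal.Quotient.field _
  let : Algebra (A ⧸ maximalIdeal A) (ResidueField A) := Algebra.id (A ⧸ maximalIdeal A)
  let : Algebra (B ⧸ maximalIdeal B) (ResidueField B) := Algebra.id (B ⧸ maximalIdeal B)
  have : IsFractionRing (A ⧸ maximalIdeal A) (ResidueField A) :=
    inferInstanceAs (IsFractionRing (A ⧸ maximalIdeal A) (A ⧸ maximalIdeal A))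
  have : IsFractionRing (B ⧸ maximalIdeal B) (ResidueField B) :=
    inferInstanceAs (IsFractionRing (B ⧸ maximalIdeal B) (B ⧸ maximalIdeal B))
  let : Algebra (A ⧸ maximalIdeal A) (ResidueField B) :=
    inferInstanceAs (Algebra (A ⧸ maximalIdeal A) (B ⧸ maximalIdeal B))
  have : IsScalarTower (A ⧸ maximalIdeal A) (B ⧸ maximalIdeal B) (ResidueField B) :=
    .of_algebraMap_eq fun _ ↦ rfl
  have : IsScalarTower (A ⧸ maximalIdeal A) (ResidueField A) (ResidueField B) :=
    .of_algebraMap_eq fun x ↦ by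
      obtain ⟨x, rfl⟩ := Ideal.Quotient.mk_surjective x
      rfl
  exact ⟨Ideal.IsFractionRing.normal G (maximalIdeal A) (maximalIdeal B) _ _,
    Group.isSolvable_of_surjective
      (IsFractionRing.stabilizerHom_surjective G (maximalIdeal A) (maximalIdeal B) _ _)⟩

end IsLocalRing.ResidueField

end ResidueFieldGalois

section SolvHenselian

open IsLocalRing Polynomial

namespace ValuationSubring

variable {K : Type*} [Field K] {O : ValuationSubring K}

theorem isSolvHenselian_iff : IsSolvHenselian O ↔
    ∀ x : solvClosure K, IsIntegral O x ∨ IsIntegral O x⁻¹ :=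
  O.existsUnique_comap_eq_iff

theorem isSolvHenselian_of_hasCyclicRoots {F : Type*} [Field F] [Algebra K F]
    (hF : HasCyclicRoots F) (h : ∀ x : F, IsIntegral O x ∨ IsIntegral O x⁻¹) :
    IsSolvHenselian O := by
  refine isSolvHenselian_iff.mpr fun x ↦ ?_
  have hx := mem_maxSolvableExt_iff.mp x.2
  have hint : IsIntegral K x := Algebra.IsIntegral.isIntegral x
  rw [IsSeparable, ← IntermediateField.minpoly_eq x] at hx
  have hirr := minpoly.irreducible hint
  obtain ⟨y, hy⟩ := hF.exists_aeval_eq_zero hx.1 hx.2 hirr.degree_pos.ne'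
  exact isIntegral_or_isIntegral_inv_of_aeval_eq_zero hirr hy (minpoly.aeval K x) (h y)

theorem _root_.IsSolvHenselian.dichotomy_of_normal (hO : IsSolvHenselian O) {E : Type*} [Field E]
    [Algebra K E] [Normal K E] (hE : Group.IsSolvable Gal(E/K)) (z : E) :
    IsIntegral O z ∨ IsIntegral O z⁻¹ := by
  obtain ⟨n, y, hy⟩ := IsPurelyInseparable.pow_mem (separableClosure K E) (ringExpChar K) z
  have hsep : IsSeparable K (y : E) := y.2
  have hirr := minpoly.irreducible hsep.isIntegral
  have : Fact (((minpoly K (y : E)).map (algebraMap K E)).Splits) := ⟨Normal.splits' (y : E)⟩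
  have hsol : Group.IsSolvable (minpoly K (y : E)).Gal :=
    Group.isSolvable_of_surjective (Gal.restrict_surjective _ E)
  obtain ⟨t, ht⟩ := IsAlgClosed.exists_aeval_eq_zero (AlgebraicClosure K) _ hirr.degree_pos.ne'
  have hmin : minpoly K t = minpoly K (y : E) :=
    (minpoly.eq_of_irreducible_of_monic hirr ht (minpoly.monic hsep.isIntegral)).symm
  have htmem : t ∈ solvClosure K :=
    mem_maxSolvableExt_iff.mpr ⟨by rw [IsSeparable, hmin]; exact hsep, hmin ▸ hsol⟩
  have hint := isIntegral_or_isIntegral_inv_of_aeval_eq_zero hirr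
    (x := (⟨t, htmem⟩ : solvClosure K)) (x' := (y : E)) ?_ (minpoly.aeval K _)
    (isSolvHenselian_iff.mp hO _)
  · have hyz : (y : E) = z ^ ringExpChar K ^ n := hy
    have hpos : 0 < ringExpChar K ^ n := pow_pos (expChar_pos K _) n
    rw [hyz, ← inv_pow] at hint
    exact hint.imp (.of_pow hpos) (.of_pow hpos)
  · apply Subtype.val_injective
    rw [← IntermediateField.aeval_coe]
    exact ht

end ValuationSubring

end SolvHenselian

section CompositeSolvHenselian

open IsLocalRing

namespace IsSolvHenselian

variable {K : Type*} [Field K] {O₁ O₂ : ValuationSubring K}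

theorem of_le (h : O₁ ≤ O₂) (h₁ : IsSolvHenselian O₁) : IsSolvHenselian O₂ :=
  ValuationSubring.isSolvHenselian_iff.mpr fun x ↦
    (ValuationSubring.isSolvHenselian_iff.mp h₁ x).imp
      (ValuationSubring.isIntegral_of_le h) (ValuationSubring.isIntegral_of_le h)

variable {Obar : ValuationSubring (ResidueField O₂)}

theorem imageResidue (h : O₁ ≤ O₂)
    (hO : (Obar : Set (ResidueField O₂)) = residue O₂ '' {x : O₂ | (x : K) ∈ O₁})
    (h₁ : IsSolvHenselian O₁) : IsSolvHenselian Obar := by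
  obtain ⟨B, _, _, _, _, _, _, _, _, _⟩ := exists_isIntegralClosure_of_dichotomy
    (ValuationSubring.isSolvHenselian_iff.mp (h₁.of_le h))
  exact ValuationSubring.isSolvHenselian_of_hasCyclicRoots
    ((hasCyclicRoots_maxSolvableExt K (AlgebraicClosure K)).residueField (B := B))
    (ValuationSubring.dichotomy_residueField (L := solvClosure K) h hO
      (ValuationSubring.isSolvHenselian_iff.mp h₁))

theorem dichotomy_of_isGalois (h : O₁ ≤ O₂)
    (hO : (Obar : Set (ResidueField O₂)) = residue O₂ '' {x : O₂ | (x : K) ∈ O₁})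
    (hObar : IsSolvHenselian Obar) {L : Type*} [Field L] [Algebra K L] [FiniteDimensional K L]
    [IsGalois K L] (hG : Group.IsSolvable Gal(L/K))
    (hL : ∀ x : L, IsIntegral O₂ x ∨ IsIntegral O₂ x⁻¹) (x : L) :
    IsIntegral O₁ x ∨ IsIntegral O₁ x⁻¹ := by
  obtain ⟨B, _, _, _, _, _, _, _, _, _⟩ := exists_isIntegralClosure_of_dichotomy hL
  let := IsIntegralClosure.MulSemiringAction O₂ K L B
  have := Algebra.isInvariant_of_isGalois O₂ K L B
  have : SMulCommClass Gal(L/K) O₂ B := ⟨fun g a b ↦ map_smul (galRestrict O₂ K L B g) a b⟩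
  obtain ⟨_, hsol⟩ := ResidueField.normal_and_isSolvable_of_isInvariant (A := O₂) (B := B)
    Gal(L/K) hG
  exact ValuationSubring.dichotomy_of_residueField h hO hL (hObar.dichotomy_of_normal hsol) x

theorem of_imageResidue (h : O₁ ≤ O₂)
    (hO : (Obar : Set (ResidueField O₂)) = residue O₂ '' {x : O₂ | (x : K) ∈ O₁})
    (h₂ : IsSolvHenselian O₂) (hObar : IsSolvHenselian Obar) : IsSolvHenselian O₁ := by
  rw [ValuationSubring.isSolvHenselian_iff] at h₂ ⊢
  intro x
  obtain ⟨L, _, _, hG, hxL⟩ := exists_isSolvable_of_mem_maxSolvableExt x.2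
  let ι : L →ₐ[K] solvClosure K := IntermediateField.inclusion (le_maxSolvableExt L hG)
  exact (dichotomy_algHom_iff O₁ ι).mpr (dichotomy_of_isGalois h hO hObar hG
    (fun y ↦ (dichotomy_algHom_iff O₂ ι).mp (h₂ (ι y))) ⟨x, hxL⟩)

end IsSolvHenselian

end CompositeSolvHenselian

/-- Let `O₁ ⊆ O₂` be valuation rings of `K`. The image of `O₁` under the
residue map `O₂ → O₂/M₂` is a valuation ring of the residue field of `O₂`, and `O₁` is
solv-henselian iff both `O₂` and this image are solv-henselian. -/
theorem statement_12 (K : Type) [Field K] (O₁ O₂ : ValuationSubring K) (h12 : O₁ ≤ O₂) :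
    (∃ Obar : ValuationSubring (IsLocalRing.ResidueField ↥O₂),
        (Obar : Set (IsLocalRing.ResidueField ↥O₂)) =
          IsLocalRing.residue ↥O₂ '' {x : ↥O₂ | (x : K) ∈ O₁}) ∧
    ∀ Obar : ValuationSubring (IsLocalRing.ResidueField ↥O₂),
      (Obar : Set (IsLocalRing.ResidueField ↥O₂)) =
          IsLocalRing.residue ↥O₂ '' {x : ↥O₂ | (x : K) ∈ O₁} →
      (IsSolvHenselian O₁ ↔ IsSolvHenselian O₂ ∧ IsSolvHenselian Obar) := by
  refine ⟨O₁.exists_coe_eq_image_residue O₂ h12, fun Obar hO ↦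
    ⟨fun h₁ ↦ ⟨h₁.of_le h12, h₁.imageResidue h12 hO⟩, fun h ↦ .of_imageResidue h12 hO h.1 h.2⟩⟩
end
end
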